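/- arXiv:1212.0787 — 3 statements merged into one kernel-verified Lean document; each statement's English description precedes it below -/
import Mathlib

section
/- Let V be a nonnegative Schwartz function on ℝ³, let 0 < β < 2/5, and let ε > 0. Then there exists a constant C > 0 such that for every integer k ≥ 0 and every ω ≥ 1 there exists N₀ = N₀(k,ω) with the following property: for every integer N ≥ N₀ satisfying N ≥ ω^{v(β)+ε} and every permutation-symmetric Schwartz function ψ on ℝ^{3N}, one has ⟨ψ, (N + H_{N,ω} − Nω)^k ψ⟩ ≥ C^k N^k ⟨ψ, ∏_{j=1}^k S_j² ψ⟩, where both sides are interpreted by repeatedly applying the differential operators (which map Schwartz functions to Schwartz functions) and pairing in L²(ℝ^{3N}). -/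
open MeasureTheory Complex

noncomputable section

/-- ℝ² with the Euclidean norm. -/
abbrev R2 : Type := EuclideanSpace ℝ (Fin 2)

/-- ℝ³ written as ℝ² × ℝ, points r = (x, z). -/
abbrev R3 : Type := R2 × ℝ

/-- Directional derivative of `f` at `p` in the direction `v`. -/
def pd {E F : Type*} [NormedAddCommGroup E] [NormedSpace ℝ E]
    [NormedAddCommGroup F] [NormedSpace ℝ F] (v : E) (f : E → F) (p : E) : F :=
  fderiv ℝ f p v

/-- Second directional derivative in the direction `v`. -/
def pd2 {E F : Type*} [NormedAddCommGroup E] [NormedSpace ℝ E]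
    [NormedAddCommGroup F] [NormedSpace ℝ F] (v : E) (f : E → F) (p : E) : F :=
  pd v (pd v f) p

/-- First coordinate direction in the x-plane. -/
def ex0 : R3 := (EuclideanSpace.single 0 1, 0)

/-- Second coordinate direction in the x-plane. -/
def ex1 : R3 := (EuclideanSpace.single 1 1, 0)

/-- The z-direction. -/
def ez : R3 := (0, 1)

/-- The full Laplacian on ℝ³ = ℝ² × ℝ. -/
def lap3 {F : Type*} [NormedAddCommGroup F] [NormedSpace ℝ F]
    (f : R3 → F) (p : R3) : F :=
  pd2 ex0 f p + pd2 ex1 f p + pd2 ez f p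

/-- The operator `S² f = (1−ω)f − Δf + ω² z² f` on functions on ℝ³. -/
def S2op (ω : ℝ) (f : R3 → ℂ) (p : R3) : ℂ :=
  ((1 - ω : ℝ) : ℂ) * f p - lap3 f p + ((ω ^ 2 * p.2 ^ 2 : ℝ) : ℂ) * f p
/-- ℝ^{3N} as N copies of ℝ³. -/
abbrev RN (N : ℕ) : Type := Fin N → R3

/-- The direction in ℝ^{3N} pointing in direction `v ∈ ℝ³` in the j-th particle slot
(for a natural-number index j; it vanishes if `j ≥ N`). -/
def dirN (N : ℕ) (j : ℕ) (v : R3) : RN N := fun i => if (i : ℕ) = j then v else 0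

/-- The z-coordinate of the j-th particle (0 if `j ≥ N`). -/
def coordZ (N : ℕ) (j : ℕ) (p : RN N) : ℝ := if h : j < N then (p ⟨j, h⟩).2 else 0

/-- The Laplacian in the variable `r_j`. -/
def lapj (N : ℕ) (j : ℕ) (f : RN N → ℂ) (p : RN N) : ℂ :=
  pd2 (dirN N j ex0) f p + pd2 (dirN N j ex1) f p + pd2 (dirN N j ez) f p

/-- The operator `S_j² f = (1−ω)f − Δ_{r_j}f + ω² z_j² f`. -/
def S2j (N : ℕ) (ω : ℝ) (j : ℕ) (f : RN N → ℂ) (p : RN N) : ℂ :=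
  ((1 - ω : ℝ) : ℂ) * f p - lapj N j f p + ((ω ^ 2 * coordZ N j p ^ 2 : ℝ) : ℂ) * f p

/-- The product `∏_{j=1}^k S_j²` (composition of the commuting operators `S_j²`,
indexed here by `j = 0, …, k−1`). -/
def Sprod (N : ℕ) (ω : ℝ) : ℕ → (RN N → ℂ) → RN N → ℂ
  | 0, f => f
  | k + 1, f => S2j N ω k (Sprod N ω k f)

/-- The Hamiltonian
`H_{N,ω}ψ = ∑_j (−Δ_{r_j}ψ + ω²z_j²ψ) + (N√ω)⁻¹ ∑_{i<j} (N√ω)^{3β} V((N√ω)^β(r_i−r_j)) ψ`. -/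
def Hop (N : ℕ) (ω β : ℝ) (V : R3 → ℝ) (f : RN N → ℂ) (p : RN N) : ℂ :=
  (∑ j : Fin N, (-lapj N (j : ℕ) f p + ((ω ^ 2 * ((p j).2) ^ 2 : ℝ) : ℂ) * f p)) +
    ((1 / ((N : ℝ) * Real.sqrt ω) : ℝ) : ℂ) *
      ∑ i : Fin N, ∑ j : Fin N,
        if i < j then
          (((((N : ℝ) * Real.sqrt ω) ^ ((3 : ℝ) * β) *
              V (((((N : ℝ) * Real.sqrt ω) ^ β : ℝ)) • (p i - p j)) : ℝ)) : ℂ) * f p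
        else 0

/-- The operator `N + H_{N,ω} − Nω`. -/
def Aop (N : ℕ) (ω β : ℝ) (V : R3 → ℝ) (f : RN N → ℂ) (p : RN N) : ℂ :=
  (N : ℂ) * f p + Hop N ω β V f p - (((N : ℝ) * ω : ℝ) : ℂ) * f p

/-- The power `(N + H_{N,ω} − Nω)^k`. -/
def Apow (N : ℕ) (ω β : ℝ) (V : R3 → ℝ) : ℕ → (RN N → ℂ) → RN N → ℂ
  | 0, f => f
  | k + 1, f => Aop N ω β V (Apow N ω β V k f)

/-- The L²(ℝ^{3N}) inner product `⟨f, g⟩ = ∫ conj(f) g`. -/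
def ipN (N : ℕ) (f g : RN N → ℂ) : ℂ := ∫ p : RN N, (starRingEnd ℂ) (f p) * g p

/-- The exponent `v(β)`. -/
def vbeta (β : ℝ) : ℝ :=
  max (max ((1 - β) / (2 * β)) ((5 / 4 * β - 1 / 12) / (1 - 5 / 2 * β)))
    (max ((1 / 2 * β + 5 / 6) / (1 - β)) ((β + 1 / 3) / (1 - 2 * β)))

/-! ### Quadratic forms of products of commuting one-particle operators -/

/-- The algebraic skeleton of a many-body Hamiltonian: one-particle operators
`S_j = ∑ₘ D_{j,m}† D_{j,m}` acting on different slots and commuting with each other, and pair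
potentials `V_{i,l}` controlled by the one-particle operators. -/
structure ManyBodySystem (N : ℕ) (E : Type*) [AddCommGroup E] [Module ℝ E] where
  form : LinearMap.BilinForm ℝ E
  form_symm : ∀ f g, form f g = form g f
  form_nonneg : ∀ f, 0 ≤ form f f
  D : Fin N → Fin 4 → Module.End ℝ E
  Dst : Fin N → Fin 4 → Module.End ℝ E
  form_Dst : ∀ j m f g, form f (Dst j m g) = form (D j m f) g
  D_zero : ∀ j, D j 0 = 1
  comm_D_D : ∀ i j m n, i ≠ j → Commute (D i m) (D j n)
  comm_D_Dst : ∀ i j m n, i ≠ j → Commute (D i m) (Dst j n)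
  comm_Dst_Dst : ∀ i j m n, i ≠ j → Commute (Dst i m) (Dst j n)
  V : Fin N → Fin N → Module.End ℝ E
  form_V : ∀ i l f g, form f (V i l g) = form (V i l f) g
  V_nonneg : ∀ i l f, 0 ≤ form f (V i l f)
  comm_D_V : ∀ j m i l, j ≠ i → j ≠ l → Commute (D j m) (V i l)
  /-- constant in the bound of a pair potential by one-particle operators, one derivative -/
  b₁ : ℝ
  /-- constant in the bound of a pair potential by one-particle operators, two derivatives -/
  b₂ : ℝ
  b₁_nonneg : 0 ≤ b₁
  b₂_nonneg : 0 ≤ b₂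
  bound_left : ∀ i l, i ≠ l → ∀ f, 0 ≤ form f (((∑ m, Dst i m * D i m) * V i l +
    b₁ • ((∑ m, Dst i m * D i m) * (∑ m, Dst l m * D l m))) f)
  bound_right : ∀ i l, i ≠ l → ∀ f, 0 ≤ form f (((∑ m, Dst l m * D l m) * V i l +
    b₁ • ((∑ m, Dst l m * D l m) * (∑ m, Dst i m * D i m))) f)
  bound_both : ∀ i l, i ≠ l → ∀ f, 0 ≤ form f (((∑ m, Dst i m * D i m) *
    ((∑ m, Dst l m * D l m) * V i l) +
    b₂ • ((∑ m, Dst i m * D i m) * (∑ m, Dst l m * D l m))) f)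
  /-- the coupling constant -/
  c : ℝ
  c_nonneg : 0 ≤ c

namespace ManyBodySystem

variable {N : ℕ} {E : Type*} [AddCommGroup E] [Module ℝ E] (M : ManyBodySystem N E)

/-- The one-particle operator in slot `j`. -/
def S (j : Fin N) : Module.End ℝ E := ∑ m, M.Dst j m * M.D j m

/-- The Hamiltonian. -/
def H : Module.End ℝ E :=
  ∑ j, M.S j + M.c • ∑ i, ∑ l, if i < l then M.V i l else 0

/-- Nonnegativity of the quadratic form of an operator. -/
def Nonneg (X : Module.End ℝ E) : Prop := ∀ f, 0 ≤ M.form f (X f)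

lemma comm_D_S {i j : Fin N} (m : Fin 4) (h : i ≠ j) : Commute (M.D i m) (M.S j) :=
  Commute.sum_right _ _ _ fun n _ => (M.comm_D_Dst i j m n h).mul_right (M.comm_D_D i j m n h)

lemma comm_S_S (i j : Fin N) : Commute (M.S i) (M.S j) := by
  rcases eq_or_ne i j with rfl | h
  · exact Commute.refl _
  · refine Commute.sum_left _ _ _ fun m _ => Commute.mul_left ?_ (M.comm_D_S m h)
    exact Commute.sum_right _ _ _ fun n _ =>
      (M.comm_Dst_Dst i j m n h).mul_right (M.comm_D_Dst j i n m h.symm).symm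

lemma form_S_apply (j : Fin N) (f g : E) :
    M.form f (M.S j g) = ∑ m, M.form (M.D j m f) (M.D j m g) := by
  simp [S, LinearMap.sum_apply, M.form_Dst]

lemma form_S (j : Fin N) (f g : E) : M.form f (M.S j g) = M.form (M.S j f) g := by
  rw [M.form_symm (M.S j f), form_S_apply, form_S_apply]
  exact Finset.sum_congr rfl fun m _ => M.form_symm _ _

lemma nonneg_S_mul {j : Fin N} {X : Module.End ℝ E} (hX : M.Nonneg X)
    (hc : ∀ m, Commute (M.D j m) X) : M.Nonneg (M.S j * X) := by
  intro f
  rw [Module.End.mul_apply, form_S_apply]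
  refine Finset.sum_nonneg fun m _ => ?_
  have := LinearMap.congr_fun (hc m).eq f
  simp only [Module.End.mul_apply] at this
  rw [this]
  exact hX _

lemma nonneg_S_sub_one (j : Fin N) : M.Nonneg (M.S j - 1) := fun f => by
  rw [LinearMap.sub_apply, map_sub, form_S_apply, Fin.sum_univ_succ, D_zero]
  simp only [Module.End.one_apply, add_sub_cancel_left]
  exact Finset.sum_nonneg fun m _ => M.form_nonneg _

lemma pairwise_comm (J : Finset (Fin N)) :
    (J : Set (Fin N)).Pairwise (Function.onFun Commute M.S) :=
  fun _ _ _ _ _ => M.comm_S_S _ _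

/-- The product of the one-particle operators over a set of slots. -/
def G (J : Finset (Fin N)) : Module.End ℝ E := J.noncommProd M.S (M.pairwise_comm J)

@[simp] lemma G_empty : M.G ∅ = 1 := rfl

lemma G_insert {J : Finset (Fin N)} {j : Fin N} (h : j ∉ J) :
    M.G (insert j J) = M.S j * M.G J := Finset.noncommProd_insert_of_notMem _ _ _ _ h

lemma G_insert' {J : Finset (Fin N)} {j : Fin N} (h : j ∉ J) :
    M.G (insert j J) = M.G J * M.S j := Finset.noncommProd_insert_of_notMem' _ _ _ _ h

lemma comm_D_G {J : Finset (Fin N)} {j : Fin N} (m : Fin 4) (h : j ∉ J) :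
    Commute (M.D j m) (M.G J) :=
  Finset.noncommProd_commute _ _ _ _ fun _ hi => M.comm_D_S m (ne_of_mem_of_not_mem hi h).symm

lemma nonneg_G_mul {J : Finset (Fin N)} {X : Module.End ℝ E} (hX : M.Nonneg X)
    (hc : ∀ j ∈ J, ∀ m, Commute (M.D j m) X) : M.Nonneg (M.G J * X) := by
  induction J using Finset.induction_on with
  | empty => simpa using hX
  | insert j J hj ih =>
    rw [M.G_insert hj, mul_assoc]
    exact M.nonneg_S_mul (ih fun i hi => hc i (Finset.mem_insert_of_mem hi)) fun m =>
      (M.comm_D_G m hj).mul_right (hc j (Finset.mem_insert_self _ _) m)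

lemma nonneg_G (J : Finset (Fin N)) : M.Nonneg (M.G J) := by
  simpa using M.nonneg_G_mul (J := J) (X := 1) (fun f => M.form_nonneg f)
    fun _ _ _ => Commute.one_right _

lemma form_G (J : Finset (Fin N)) (f g : E) : M.form f (M.G J g) = M.form (M.G J f) g := by
  induction J using Finset.induction_on generalizing f g with
  | empty => rfl
  | insert j J hj ih =>
    rw [M.G_insert hj, Module.End.mul_apply, form_S, ih, ← Module.End.mul_apply,
      ← M.G_insert' hj, M.G_insert hj]

/-- The expectation of `G J`. -/
def g (f : E) (J : Finset (Fin N)) : ℝ := M.form f (M.G J f)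

lemma g_nonneg (f : E) (J : Finset (Fin N)) : 0 ≤ M.g f J := M.nonneg_G J f

lemma g_le_insert (f : E) {J : Finset (Fin N)} {l : Fin N} (h : l ∉ J) :
    M.g f J ≤ M.g f (insert l J) := by
  have := M.nonneg_G_mul (J := J) (M.nonneg_S_sub_one l) (fun j hj m =>
    (M.comm_D_S m (ne_of_mem_of_not_mem hj h)).sub_right (Commute.one_right _)) f
  rw [mul_sub, mul_one, ← M.G_insert' h, LinearMap.sub_apply, map_sub] at this
  exact sub_nonneg.1 this

lemma erase_spec {J : Finset (Fin N)} {i : Fin N} (hi : i ∈ J) :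
    M.G J = M.G (J.erase i) * M.S i := by
  conv_lhs => rw [← Finset.insert_erase hi]
  exact M.G_insert' (Finset.notMem_erase _ _)

/-- A pair potential after `G J` is nonnegative if it acts on slots outside `J`. -/
lemma form_G_V_disjoint (f : E) {J : Finset (Fin N)} {i l : Fin N} (hi : i ∉ J) (hl : l ∉ J) :
    0 ≤ M.form f (M.G J (M.V i l f)) :=
  M.nonneg_G_mul (M.V_nonneg i l) (fun j hj m => M.comm_D_V j m i l
    (fun e => hi (e ▸ hj)) (fun e => hl (e ▸ hj))) f

lemma form_G_V_left (f : E) {J : Finset (Fin N)} {i l : Fin N} (hi : i ∈ J) (hl : l ∉ J) :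
    -(M.b₁ * M.g f (insert l J)) ≤ M.form f (M.G J (M.V i l f)) := by
  have hil : i ≠ l := ne_of_mem_of_not_mem hi hl
  have hne : ∀ j ∈ J.erase i, j ≠ i ∧ j ≠ l := fun j hj =>
    ⟨Finset.ne_of_mem_erase hj, ne_of_mem_of_not_mem (Finset.mem_of_mem_erase hj) hl⟩
  have h := M.nonneg_G_mul (J := J.erase i) (X := M.S i * M.V i l + M.b₁ • (M.S i * M.S l))
    (M.bound_left i l hil) (fun j hj m =>
      ((M.comm_D_S m (hne j hj).1).mul_right (M.comm_D_V j m i l (hne j hj).1 (hne j hj).2)).add_right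
      (((M.comm_D_S m (hne j hj).1).mul_right (M.comm_D_S m (hne j hj).2)).smul_right _)) f
  rw [mul_add, mul_smul_comm, ← mul_assoc, ← mul_assoc, ← M.erase_spec hi, ← M.G_insert' hl] at h
  simp only [LinearMap.add_apply, LinearMap.smul_apply, map_add, map_smul, smul_eq_mul,
    Module.End.mul_apply] at h
  rw [g]
  linarith

lemma form_G_V_right (f : E) {J : Finset (Fin N)} {i l : Fin N} (hi : i ∉ J) (hl : l ∈ J) :
    -(M.b₁ * M.g f (insert i J)) ≤ M.form f (M.G J (M.V i l f)) := by
  have hil : i ≠ l := (ne_of_mem_of_not_mem hl hi).symm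
  have hne : ∀ j ∈ J.erase l, j ≠ l ∧ j ≠ i := fun j hj =>
    ⟨Finset.ne_of_mem_erase hj, ne_of_mem_of_not_mem (Finset.mem_of_mem_erase hj) hi⟩
  have h := M.nonneg_G_mul (J := J.erase l) (X := M.S l * M.V i l + M.b₁ • (M.S l * M.S i))
    (M.bound_right i l hil) (fun j hj m =>
      ((M.comm_D_S m (hne j hj).1).mul_right (M.comm_D_V j m i l (hne j hj).2 (hne j hj).1)).add_right
      (((M.comm_D_S m (hne j hj).1).mul_right (M.comm_D_S m (hne j hj).2)).smul_right _)) f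
  rw [mul_add, mul_smul_comm, ← mul_assoc, ← mul_assoc, ← M.erase_spec hl, ← M.G_insert' hi] at h
  simp only [LinearMap.add_apply, LinearMap.smul_apply, map_add, map_smul, smul_eq_mul,
    Module.End.mul_apply] at h
  rw [g]
  linarith

lemma form_G_V_both (f : E) {J : Finset (Fin N)} {i l : Fin N} (hil : i ≠ l) (hi : i ∈ J)
    (hl : l ∈ J) : -(M.b₂ * M.g f J) ≤ M.form f (M.G J (M.V i l f)) := by
  have hne : ∀ j ∈ (J.erase l).erase i, j ≠ i ∧ j ≠ l := fun j hj =>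
    ⟨Finset.ne_of_mem_erase hj, Finset.ne_of_mem_erase (Finset.mem_of_mem_erase hj)⟩
  have h := M.nonneg_G_mul (J := (J.erase l).erase i)
    (X := M.S i * (M.S l * M.V i l) + M.b₂ • (M.S i * M.S l))
    (M.bound_both i l hil) (fun j hj m =>
      ((M.comm_D_S m (hne j hj).1).mul_right ((M.comm_D_S m (hne j hj).2).mul_right
        (M.comm_D_V j m i l (hne j hj).1 (hne j hj).2))).add_right
      (((M.comm_D_S m (hne j hj).1).mul_right (M.comm_D_S m (hne j hj).2)).smul_right _)) f
  have hi' : i ∈ J.erase l := Finset.mem_erase.2 ⟨hil, hi⟩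
  rw [mul_add, mul_smul_comm, ← mul_assoc, ← mul_assoc, ← mul_assoc, ← M.erase_spec hi',
    ← M.erase_spec hl] at h
  simp only [LinearMap.add_apply, LinearMap.smul_apply, map_add, map_smul, smul_eq_mul,
    Module.End.mul_apply] at h
  rw [g]
  linarith

/-- Sum of a function of sets over all one-point extensions. -/
def ext (Φ : Finset (Fin N) → ℝ) (J : Finset (Fin N)) : ℝ := ∑ j ∈ Jᶜ, Φ (insert j J)

lemma ext_g_nonneg (f : E) (J : Finset (Fin N)) : 0 ≤ ext (M.g f) J :=
  Finset.sum_nonneg fun _ _ => M.g_nonneg _ _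

/-- The sum of all pair potentials after `G J`. -/
lemma form_G_sum_V (f : E) (J : Finset (Fin N)) :
    -(2 * M.b₁ * J.card * ext (M.g f) J + M.b₂ * J.card ^ 2 * M.g f J) ≤
      M.form f (M.G J ((∑ i, ∑ l, if i < l then M.V i l else 0 : Module.End ℝ E) f)) := by
  have key : ∀ i l, -(M.b₁ * (if i ∈ J then (if l ∈ Jᶜ then M.g f (insert l J) else 0) else 0) +
      M.b₁ * (if l ∈ J then (if i ∈ Jᶜ then M.g f (insert i J) else 0) else 0) +
      M.b₂ * (if i ∈ J then (if l ∈ J then M.g f J else 0) else 0)) ≤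
      M.form f (M.G J ((if i < l then M.V i l else 0 : Module.End ℝ E) f)) := by
    intro i l
    have h1 := M.b₁_nonneg
    have h2 := M.b₂_nonneg
    have g1 := mul_nonneg h1 (M.g_nonneg f (insert l J))
    have g2 := mul_nonneg h1 (M.g_nonneg f (insert i J))
    have g3 := mul_nonneg h2 (M.g_nonneg f J)
    by_cases hil : i < l
    · by_cases hi : i ∈ J <;> by_cases hl : l ∈ J
      · simpa [hi, hl, hil] using M.form_G_V_both f hil.ne hi hl
      · simpa [hi, hl, hil] using M.form_G_V_left f hi hl
      · simpa [hi, hl, hil] using M.form_G_V_right f hi hl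
      · simpa [hi, hl, hil] using M.form_G_V_disjoint f hi hl
    · by_cases hi : i ∈ J <;> by_cases hl : l ∈ J <;> simp [hi, hl, hil] <;> linarith
  have hsum := Finset.sum_le_sum fun i (_ : i ∈ Finset.univ) =>
    Finset.sum_le_sum fun l (_ : l ∈ Finset.univ) => key i l
  simp only [LinearMap.sum_apply, map_sum]
  refine le_trans (le_of_eq ?_) hsum
  have e1 : ∑ i, ∑ l, (if i ∈ J then (if l ∈ Jᶜ then M.g f (insert l J) else 0) else 0) =
      J.card * ext (M.g f) J := by
    have : ∀ i : Fin N, ∑ l, (if i ∈ J then (if l ∈ Jᶜ then M.g f (insert l J) else 0) else 0) =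
        if i ∈ J then ext (M.g f) J else 0 := by
      intro i
      split_ifs
      · rw [Finset.sum_ite_mem, Finset.univ_inter]; rfl
      · simp
    simp only [this]
    rw [Finset.sum_ite_mem, Finset.univ_inter, Finset.sum_const, nsmul_eq_mul]
  have e2 : ∑ i, ∑ l, (if l ∈ J then (if i ∈ Jᶜ then M.g f (insert i J) else 0) else 0) =
      J.card * ext (M.g f) J := by
    rw [Finset.sum_comm]; exact e1
  have e3 : ∑ i, ∑ l, (if i ∈ J then (if l ∈ J then M.g f J else 0) else 0) =
      J.card ^ 2 * M.g f J := by
    have : ∀ i : Fin N, ∑ l, (if i ∈ J then (if l ∈ J then M.g f J else 0) else 0) =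
        if i ∈ J then J.card * M.g f J else 0 := by
      intro i
      split_ifs
      · rw [Finset.sum_ite_mem, Finset.univ_inter, Finset.sum_const, nsmul_eq_mul]
      · simp
    simp only [this]
    rw [Finset.sum_ite_mem, Finset.univ_inter, Finset.sum_const, nsmul_eq_mul]
    ring
  simp only [Finset.sum_neg_distrib, Finset.sum_add_distrib, ← Finset.mul_sum, e1, e2, e3]
  ring

lemma card_mul_g_le_ext (f : E) (J : Finset (Fin N)) :
    ((N : ℝ) - J.card) * M.g f J ≤ ext (M.g f) J := by
  have h : ∑ _j ∈ Jᶜ, M.g f J ≤ ext (M.g f) J :=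
    Finset.sum_le_sum fun j hj => M.g_le_insert f (Finset.mem_compl.1 hj)
  have hc : ((Jᶜ.card : ℕ) : ℝ) = (N : ℝ) - J.card := by
    rw [Finset.card_compl, Fintype.card_fin, Nat.cast_sub (by simpa using Finset.card_le_univ J)]
  rwa [Finset.sum_const, nsmul_eq_mul, hc] at h

/-- Conjugating `G J` with the Hamiltonian adds two one-particle operators. -/
lemma g_H_ge (f : E) (J : Finset (Fin N))
    (h₁ : 4 * M.c * M.b₁ * (J.card + 1) ≤ 3 / 8)
    (h₂ : 2 * M.c * M.b₂ * (J.card + 1) ^ 2 ≤ 3 / 8 * (N - (J.card + 1))) :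
    1 / 4 * ext (ext (M.g f)) J ≤ M.g (M.H f) J := by
  set h := ∑ j ∈ Jᶜ, M.S j f with hh
  set W : Module.End ℝ E := ∑ i, ∑ l, if i < l then M.V i l else 0 with hW
  set B := (∑ j ∈ J, M.S j f) + M.c • W f with hB
  have hH : M.H f = h + B := by
    rw [H, LinearMap.add_apply, LinearMap.sum_apply, LinearMap.smul_apply, hB, ← add_assoc, hh,
      add_comm (∑ j ∈ Jᶜ, M.S j f), Finset.sum_add_sum_compl]
  have hS : ∀ x, M.form h (M.G J x) = ∑ j ∈ Jᶜ, M.form f (M.G (insert j J) x) := by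
    intro x
    rw [hh, map_sum, LinearMap.sum_apply]
    refine Finset.sum_congr rfl fun j hj => ?_
    rw [← form_S, ← Module.End.mul_apply, ← M.G_insert (Finset.mem_compl.1 hj)]
  have e0 : M.g (M.H f) J = M.form h (M.G J h) + 2 * M.form h (M.G J B) + M.form B (M.G J B) := by
    have : M.form B (M.G J h) = M.form h (M.G J B) := by rw [form_G, M.form_symm]
    rw [g, hH]
    simp only [map_add, LinearMap.add_apply, this]
    ring
  have e1 : ext (ext (M.g f)) J ≤ M.form h (M.G J h) := by
    rw [hS]
    refine Finset.sum_le_sum fun j hj => ?_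
    have hj' := Finset.mem_compl.1 hj
    have hJc : Jᶜ = insert j (insert j J)ᶜ := by
      ext x
      by_cases hx : x = j <;> simp [hx, hj']
    rw [hh, map_sum, map_sum, hJc, Finset.sum_insert (by simp)]
    have t1 : 0 ≤ M.form f (M.G (insert j J) (M.S j f)) := by
      rw [M.G_insert' hj', ← Module.End.mul_apply, mul_assoc]
      refine M.nonneg_G_mul (X := M.S j * M.S j) (fun x => ?_) (fun i hi m => ?_) f
      · rw [Module.End.mul_apply, form_S]; exact M.form_nonneg _
      · have := M.comm_D_S m (i := i) (j := j) fun e => hj' (e ▸ hi)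
        exact this.mul_right this
    have t2 : ∀ l ∈ (insert j J)ᶜ, M.form f (M.G (insert j J) (M.S l f)) =
        M.g f (insert l (insert j J)) := by
      intro l hl
      rw [g, M.G_insert' (Finset.mem_compl.1 hl), Module.End.mul_apply]
    rw [Finset.sum_congr rfl t2, ext]
    linarith
  have e2 : -(M.c * (2 * M.b₁ * (J.card + 1) * ext (ext (M.g f)) J +
      M.b₂ * (J.card + 1) ^ 2 * ext (M.g f) J)) ≤ M.form h (M.G J B) := by
    rw [hS]
    have : ∀ j ∈ Jᶜ, -(M.c * (2 * M.b₁ * (J.card + 1) * ext (M.g f) (insert j J) +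
        M.b₂ * (J.card + 1) ^ 2 * M.g f (insert j J))) ≤ M.form f (M.G (insert j J) B) := by
      intro j hj
      have hj' := Finset.mem_compl.1 hj
      rw [hB, map_add, map_add, map_smul, map_smul, map_sum, map_sum, smul_eq_mul]
      have t1 : 0 ≤ ∑ i ∈ J, M.form f (M.G (insert j J) (M.S i f)) := by
        refine Finset.sum_nonneg fun i hi => ?_
        rw [M.erase_spec (Finset.mem_insert_of_mem hi), ← Module.End.mul_apply, mul_assoc]
        refine M.nonneg_G_mul (X := M.S i * M.S i) (fun x => ?_) (fun i' hi' m => ?_) f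
        · rw [Module.End.mul_apply, form_S]; exact M.form_nonneg _
        · have := M.comm_D_S m (i := i') (j := i) (Finset.ne_of_mem_erase hi')
          exact this.mul_right this
      have t2 := mul_le_mul_of_nonneg_left (M.form_G_sum_V f (insert j J)) M.c_nonneg
      rw [Finset.card_insert_of_notMem hj', Nat.cast_succ, ← hW] at t2
      linarith
    refine le_trans (le_of_eq ?_) (Finset.sum_le_sum this)
    rw [Finset.sum_neg_distrib, ← Finset.mul_sum, Finset.sum_add_distrib, ← Finset.mul_sum,
      ← Finset.mul_sum]
    rfl
  have e3 : 0 ≤ M.form B (M.G J B) := M.nonneg_G J B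
  have e4 : ((N : ℝ) - (J.card + 1)) * ext (M.g f) J ≤ ext (ext (M.g f)) J := by
    rw [ext, Finset.mul_sum]
    refine Finset.sum_le_sum fun j hj => ?_
    have := M.card_mul_g_le_ext f (insert j J)
    rwa [Finset.card_insert_of_notMem (Finset.mem_compl.1 hj), Nat.cast_succ] at this
  have hE2 : 0 ≤ ext (ext (M.g f)) J := Finset.sum_nonneg fun _ _ => M.ext_g_nonneg _ _
  have f1 := mul_le_mul_of_nonneg_right h₁ hE2
  have f2 := mul_le_mul_of_nonneg_right h₂ (M.ext_g_nonneg f J)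
  nlinarith

lemma ext_iterate_mono {Φ Ψ : Finset (Fin N) → ℝ} {k : ℕ} {J : Finset (Fin N)}
    (h : ∀ K : Finset (Fin N), K.card = J.card + k → Φ K ≤ Ψ K) :
    ext^[k] Φ J ≤ ext^[k] Ψ J := by
  induction k generalizing J with
  | zero => exact h J rfl
  | succ k ih =>
    rw [Function.iterate_succ_apply', Function.iterate_succ_apply']
    refine Finset.sum_le_sum fun j hj => ih fun K hK => h K ?_
    rw [hK, Finset.card_insert_of_notMem (Finset.mem_compl.1 hj)]
    ring

lemma ext_iterate_smul (a : ℝ) (Φ : Finset (Fin N) → ℝ) (k : ℕ) (J : Finset (Fin N)) :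
    ext^[k] (fun K => a * Φ K) J = a * ext^[k] Φ J := by
  induction k generalizing J with
  | zero => rfl
  | succ k ih =>
    rw [Function.iterate_succ_apply', Function.iterate_succ_apply', ext, ext, Finset.mul_sum]
    exact Finset.sum_congr rfl fun j _ => ih _

lemma form_H (f g : E) : M.form f (M.H g) = M.form (M.H f) g := by
  simp only [H, LinearMap.add_apply, LinearMap.sum_apply, LinearMap.smul_apply, map_add, map_sum,
    map_smul, form_S, smul_eq_mul]
  congr 2
  refine Finset.sum_congr rfl fun i _ => Finset.sum_congr rfl fun l _ => ?_
  split_ifs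
  · exact M.form_V i l f g
  · simp

/-- Lower bound of powers of the Hamiltonian by products of one-particle operators over tuples of
distinct slots. -/
lemma form_H_pow_ge (k : ℕ)
    (h₁ : 4 * M.c * M.b₁ * (k + 1) ≤ 3 / 8)
    (h₂ : 2 * M.c * M.b₂ * (k + 1) ^ 2 ≤ 3 / 8 * (N - (k + 1))) (f : E) :
    (1 / 2) ^ k * ext^[k] (M.g f) ∅ ≤ M.form f ((M.H ^ k) f) := by
  suffices ∀ n, n ≤ k → ∀ f, (1 / 2) ^ n * ext^[n] (M.g f) ∅ ≤ M.form f ((M.H ^ n) f) from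
    this k le_rfl f
  intro n
  induction n using Nat.strong_induction_on with
  | _ n ih =>
  intro hn f
  match n, ih, hn with
  | 0, _, _ => simp [g]
  | 1, _, _ =>
    have hV : 0 ≤ M.form f ((∑ i, ∑ l, if i < l then M.V i l else 0 : Module.End ℝ E) f) := by
      simpa using M.form_G_sum_V f ∅
    have hS : ext (M.g f) ∅ = M.form f ((∑ j, M.S j : Module.End ℝ E) f) := by
      have hG : ∀ j, M.G {j} = M.S j := fun j => by simp [G]
      simp [ext, g, LinearMap.sum_apply, hG]
    have h0 := M.ext_g_nonneg f ∅
    have := mul_nonneg M.c_nonneg hV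
    rw [pow_one, pow_one, H, LinearMap.add_apply, LinearMap.smul_apply, map_add, ← hS, map_smul,
      smul_eq_mul, Function.iterate_one]
    linarith
  | n + 2, ih, hn =>
    have e1 : M.form f ((M.H ^ (n + 2)) f) = M.form (M.H f) ((M.H ^ n) (M.H f)) := by
      rw [← form_H, ← Module.End.mul_apply, ← Module.End.mul_apply, ← pow_succ', ← pow_succ]
    rw [e1]
    refine le_trans ?_ (ih n (by omega) (by omega) (M.H f))
    have hnk : (n : ℝ) ≤ k := by exact_mod_cast (by omega : n ≤ k)
    have hb1 := mul_nonneg M.c_nonneg M.b₁_nonneg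
    have hb2 := mul_nonneg M.c_nonneg M.b₂_nonneg
    have hmono : ext^[n] (fun K => 1 / 4 * ext (ext (M.g f)) K) ∅ ≤ ext^[n] (M.g (M.H f)) ∅ := by
      refine ext_iterate_mono fun K hK => ?_
      rw [Finset.card_empty, zero_add] at hK
      refine M.g_H_ge f K ?_ ?_ <;> rw [hK]
      · refine le_trans ?_ h₁
        nlinarith
      · have : ((n : ℝ) + 1) ^ 2 ≤ (k + 1) ^ 2 := by gcongr
        nlinarith
    rw [ext_iterate_smul] at hmono
    rw [Function.iterate_add_apply, Function.iterate_succ_apply, Function.iterate_one]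
    calc (1 / 2 : ℝ) ^ (n + 2) * ext^[n] (ext (ext (M.g f))) ∅
        = (1 / 2) ^ n * (1 / 4 * ext^[n] (ext (ext (M.g f))) ∅) := by ring
      _ ≤ _ := by gcongr

lemma ext_iterate_ge {f : E} {t : ℕ → ℝ} (ht : ∀ J, M.g f J = t J.card)
    (k : ℕ) (J : Finset (Fin N)) (hJ : 2 * (J.card + k) ≤ N) :
    ((N : ℝ) / 2) ^ k * t (J.card + k) ≤ ext^[k] (M.g f) J := by
  induction k generalizing J with
  | zero => simp [ht]
  | succ k ih =>
    rw [Function.iterate_succ_apply']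
    have h1 : ∑ _j ∈ Jᶜ, ((N : ℝ) / 2) ^ k * t (J.card + (k + 1)) ≤ ext (ext^[k] (M.g f)) J := by
      refine Finset.sum_le_sum fun j hj => ?_
      have hc := Finset.card_insert_of_notMem (Finset.mem_compl.1 hj)
      have := ih (insert j J) (by omega)
      rwa [hc, add_assoc, add_comm 1 k] at this
    have hc : ((Jᶜ.card : ℕ) : ℝ) = (N : ℝ) - J.card := by
      rw [Finset.card_compl, Fintype.card_fin,
        Nat.cast_sub (by simpa using Finset.card_le_univ J)]
    rw [Finset.sum_const, nsmul_eq_mul, hc] at h1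
    have hN : (2 * (J.card + (k + 1)) : ℝ) ≤ N := by exact_mod_cast hJ
    have hk : (0 : ℝ) ≤ k := Nat.cast_nonneg k
    have ht0 : 0 ≤ t (J.card + (k + 1)) := by
      obtain ⟨K, hK⟩ := Finset.exists_subset_card_eq (s := (Finset.univ : Finset (Fin N)))
        (n := J.card + (k + 1)) (by simp; omega)
      rw [← hK.2, ← ht]
      exact M.g_nonneg _ _
    refine le_trans ?_ h1
    rw [pow_succ', mul_assoc]
    have h0 : 0 ≤ ((N : ℝ) / 2) ^ k * t (J.card + (k + 1)) := by positivity
    gcongr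
    have : (0 : ℝ) ≤ J.card := Nat.cast_nonneg _
    linarith

/-- The energy estimate for vectors on which the expectation of `G J` depends only on the size
of `J`. -/
theorem energy_estimate_of_card {f : E} {t : ℕ → ℝ} (ht : ∀ J, M.g f J = t J.card)
    (k : ℕ) (hk : 2 * k + 2 ≤ N) (h₁ : 4 * M.c * M.b₁ * (k + 1) ≤ 3 / 8)
    (h₂ : 2 * M.c * M.b₂ * (k + 1) ^ 2 ≤ 3 / 8 * (N - (k + 1))) :
    (1 / 4) ^ k * (N : ℝ) ^ k * t k ≤ M.form f ((M.H ^ k) f) := by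
  refine le_trans ?_ (M.form_H_pow_ge k h₁ h₂ f)
  have := M.ext_iterate_ge ht k ∅ (by simp; omega)
  rw [Finset.card_empty, zero_add] at this
  calc (1 / 4 : ℝ) ^ k * (N : ℝ) ^ k * t k = (1 / 2) ^ k * (((N : ℝ) / 2) ^ k * t k) := by
        rw [← mul_assoc, ← mul_pow, ← mul_pow]; ring_nf
    _ ≤ _ := by gcongr

end ManyBodySystem

/-! ### Multiplication and differentiation operators on Schwartz functions -/

namespace SchwartzOp

open SchwartzMap LineDeriv Function

variable {E : Type*} [NormedAddCommGroup E] [NormedSpace ℝ E]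

/-- Multiplication by a real function of temperate growth. -/
def mulOp (h : E → ℝ) : Module.End ℝ (SchwartzMap E ℂ) := (smulLeftCLM ℂ h).toLinearMap

/-- The directional derivative. -/
def derivOp (v : E) : Module.End ℝ (SchwartzMap E ℂ) :=
  (lineDerivOpCLM ℝ (SchwartzMap E ℂ) v).toLinearMap

lemma mulOp_apply {h : E → ℝ} (hh : h.HasTemperateGrowth) (f : SchwartzMap E ℂ) (p : E) :
    mulOp h f p = h p • f p := smulLeftCLM_apply_apply hh f p

lemma derivOp_apply (v : E) (f : SchwartzMap E ℂ) (p : E) :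
    derivOp v f p = fderiv ℝ f p v := lineDerivOp_apply_eq_fderiv v f p

lemma commute_mulOp {h k : E → ℝ} (hh : h.HasTemperateGrowth) (hk : k.HasTemperateGrowth) :
    Commute (mulOp h) (mulOp k) := by
  refine LinearMap.ext fun f => SchwartzMap.ext fun p => ?_
  simp only [Module.End.mul_apply, mulOp_apply hh, mulOp_apply hk]
  rw [smul_comm]

lemma commute_derivOp (v w : E) : Commute (derivOp v) (derivOp w) := by
  refine LinearMap.ext fun f => SchwartzMap.ext fun p => ?_
  have key : ∀ v w : E, derivOp v (derivOp w f) p = fderiv ℝ (fderiv ℝ f) p v w := by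
    intro v w
    have h : ⇑(derivOp w f) = fun q => fderiv ℝ f q w := funext (derivOp_apply w f)
    have hd : DifferentiableAt ℝ (fderiv ℝ f) p :=
      ((f.smooth 2).fderiv_right (m := 1) le_rfl).differentiable one_ne_zero p
    rw [derivOp_apply, h, fderiv_clm_apply hd (differentiableAt_const w)]
    simp
  rw [Module.End.mul_apply, Module.End.mul_apply, key, key]
  exact second_derivative_symmetric (f' := fderiv ℝ f)
    (fun q => (f.differentiable q).hasFDerivAt)
    (((f.smooth 2).fderiv_right (m := 1) le_rfl).differentiable one_ne_zero p).hasFDerivAt v w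

lemma derivOp_mulOp {h h' : E → ℝ} {v : E} (hh : h.HasTemperateGrowth)
    (hh' : h'.HasTemperateGrowth) (hd : ∀ p, fderiv ℝ h p v = h' p) :
    derivOp v * mulOp h = mulOp h * derivOp v + mulOp h' := by
  refine LinearMap.ext fun f => SchwartzMap.ext fun p => ?_
  have e : ⇑(mulOp h f) = fun q => h q • f q := funext (mulOp_apply hh f)
  rw [Module.End.mul_apply, derivOp_apply, e,
    fderiv_fun_smul (hh.1.differentiable (by simp) p) (f.differentiable p)]
  simp [Module.End.mul_apply, mulOp_apply hh, mulOp_apply hh', derivOp_apply, hd]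

lemma commute_derivOp_mulOp {h : E → ℝ} {v : E} (hh : h.HasTemperateGrowth)
    (hd : ∀ p, fderiv ℝ h p v = 0) : Commute (derivOp v) (mulOp h) := by
  have := derivOp_mulOp (h' := fun _ => 0) hh (.const 0) hd
  have h0 : mulOp (fun _ : E => (0 : ℝ)) = 0 := by
    refine LinearMap.ext fun f => SchwartzMap.ext fun p => ?_
    simp [mulOp_apply (.const 0)]
  rwa [h0, add_zero] at this

/-- First order operators `D_m = ∂_{v_m} + h_m` acting on one slot, with `D_0 = 1` and with the
derivative of `h_m` along `v_m` constant. -/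
structure Slot (E : Type*) [NormedAddCommGroup E] [NormedSpace ℝ E] where
  dir : Fin 4 → E
  fn : Fin 4 → E → ℝ
  temperate : ∀ m, (fn m).HasTemperateGrowth
  slope : Fin 4 → ℝ
  fderiv_fn : ∀ m p, fderiv ℝ (fn m) p (dir m) = slope m
  slope_nonneg : ∀ m, 0 ≤ slope m
  dir_zero : dir 0 = 0
  fn_zero : fn 0 = fun _ => 1

namespace Slot

/-- The operator `∂_{v_m} + h_m`. -/
def D (s : Slot E) (m : Fin 4) : Module.End ℝ (SchwartzMap E ℂ) :=
  derivOp (s.dir m) + mulOp (s.fn m)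

/-- The adjoint `-∂_{v_m} + h_m`. -/
def Dst (s : Slot E) (m : Fin 4) : Module.End ℝ (SchwartzMap E ℂ) :=
  -derivOp (s.dir m) + mulOp (s.fn m)

lemma D_zero (s : Slot E) : s.D 0 = 1 := by
  refine LinearMap.ext fun f => SchwartzMap.ext fun p => ?_
  have h := s.temperate 0
  rw [s.fn_zero] at h
  simp [D, s.dir_zero, s.fn_zero, derivOp_apply, mulOp_apply h]

/-- Two slots are independent if the functions of each are constant along the directions of the
other. -/
structure Indep (s t : Slot E) : Prop where
  left : ∀ m n p, fderiv ℝ (s.fn m) p (t.dir n) = 0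
  right : ∀ m n p, fderiv ℝ (t.fn n) p (s.dir m) = 0

lemma Indep.symm {s t : Slot E} (h : s.Indep t) : t.Indep s :=
  ⟨fun m n => h.right n m, fun m n => h.left n m⟩

section Commute

variable {s t : Slot E} (h : s.Indep t) (m n : Fin 4)
include h

lemma Indep.commute_deriv_fn : Commute (derivOp (s.dir m)) (mulOp (t.fn n)) :=
  commute_derivOp_mulOp (t.temperate n) (h.right m n)

lemma Indep.commute_D_D : Commute (s.D m) (t.D n) :=
  ((commute_derivOp _ _).add_right (h.commute_deriv_fn m n)).add_left
    ((h.symm.commute_deriv_fn n m).symm.add_right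
      (commute_mulOp (s.temperate m) (t.temperate n)))

lemma Indep.commute_D_Dst : Commute (s.D m) (t.Dst n) :=
  ((commute_derivOp (s.dir m) (t.dir n)).neg_right.add_right (h.commute_deriv_fn m n)).add_left
    ((h.symm.commute_deriv_fn n m).symm.neg_right.add_right
      (commute_mulOp (s.temperate m) (t.temperate n)))

lemma Indep.commute_Dst_Dst : Commute (s.Dst m) (t.Dst n) :=
  ((commute_derivOp (s.dir m) (t.dir n)).neg_right.neg_left.add_right
    (h.commute_deriv_fn m n).neg_left).add_left
    ((h.symm.commute_deriv_fn n m).symm.neg_right.add_right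
      (commute_mulOp (s.temperate m) (t.temperate n)))

end Commute

lemma commute_D_mulOp (s : Slot E) {u : E → ℝ} (hu : u.HasTemperateGrowth) (m : Fin 4)
    (hd : ∀ p, fderiv ℝ u p (s.dir m) = 0) : Commute (s.D m) (mulOp u) :=
  (commute_derivOp_mulOp hu hd).add_left (commute_mulOp (s.temperate m) hu)

lemma D_mulOp (s : Slot E) {u u' : E → ℝ} (hu : u.HasTemperateGrowth)
    (hu' : u'.HasTemperateGrowth) (m : Fin 4) (hd : ∀ p, fderiv ℝ u p (s.dir m) = u' p)
    (f : SchwartzMap E ℂ) :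
    s.D m (mulOp u f) = mulOp u (s.D m f) + mulOp u' f := by
  have h1 := LinearMap.congr_fun (derivOp_mulOp hu hu' hd) f
  have h2 := LinearMap.congr_fun (commute_mulOp (s.temperate m) hu).eq f
  simp only [Module.End.mul_apply, LinearMap.add_apply] at h1 h2
  simp only [D, LinearMap.add_apply, map_add, h1, h2]
  abel

end Slot

variable [MeasurableSpace E] [BorelSpace E] [FiniteDimensional ℝ E]
  (μ : Measure E) [μ.IsAddHaarMeasure]

lemma integrable_inner (f g : SchwartzMap E ℂ) : Integrable (fun p => inner ℝ (f p) (g p)) μ :=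
  (bilinLeftCLM (𝕜 := ℝ) (innerSL ℝ) g.hasTemperateGrowth f).integrable

/-- The real `L²` inner product. -/
def l2form : LinearMap.BilinForm ℝ (SchwartzMap E ℂ) :=
  LinearMap.mk₂ ℝ (fun f g => ∫ p, inner ℝ (f p) (g p) ∂μ)
    (fun f f' g => by
      simp only [_root_.add_apply, inner_add_left]
      exact integral_add (integrable_inner μ f g) (integrable_inner μ f' g))
    (fun c f g => by
      simp only [_root_.smul_apply, real_inner_smul_left]
      exact integral_const_mul _ _)
    (fun f g g' => by
      simp only [_root_.add_apply, inner_add_right]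
      exact integral_add (integrable_inner μ f g) (integrable_inner μ f g'))
    (fun c f g => by
      simp only [_root_.smul_apply, real_inner_smul_right]
      exact integral_const_mul _ _)

lemma l2form_apply (f g : SchwartzMap E ℂ) :
    l2form μ f g = ∫ p, inner ℝ (f p) (g p) ∂μ := rfl

lemma l2form_symm (f g : SchwartzMap E ℂ) : l2form μ f g = l2form μ g f := by
  simp only [l2form_apply]
  exact integral_congr_ae (.of_forall fun p => real_inner_comm _ _)

lemma l2form_nonneg (f : SchwartzMap E ℂ) : 0 ≤ l2form μ f f :=
  integral_nonneg fun _ => real_inner_self_nonneg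

lemma l2form_mulOp {h : E → ℝ} (hh : h.HasTemperateGrowth) (f g : SchwartzMap E ℂ) :
    l2form μ f (mulOp h g) = l2form μ (mulOp h f) g := by
  simp only [l2form_apply, mulOp_apply hh, real_inner_smul_left, real_inner_smul_right]

lemma l2form_derivOp (v : E) (f g : SchwartzMap E ℂ) :
    l2form μ f (derivOp v g) = - l2form μ (derivOp v f) g :=
  integral_bilinear_lineDerivOp_right_eq_neg_left f g (innerSL ℝ) v

lemma l2form_mulOp_mono {h k : E → ℝ} (hh : h.HasTemperateGrowth) (hk : k.HasTemperateGrowth)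
    (hle : ∀ p, h p ≤ k p) (f : SchwartzMap E ℂ) :
    l2form μ f (mulOp h f) ≤ l2form μ f (mulOp k f) := by
  refine integral_mono (integrable_inner μ _ _) (integrable_inner μ _ _) fun p => ?_
  simp only [mulOp_apply hh, mulOp_apply hk, real_inner_smul_right]
  exact mul_le_mul_of_nonneg_right (hle p) real_inner_self_nonneg

lemma l2form_mulOp_nonneg {h : E → ℝ} (hh : h.HasTemperateGrowth) (hle : ∀ p, 0 ≤ h p)
    (f : SchwartzMap E ℂ) : 0 ≤ l2form μ f (mulOp h f) := by
  refine integral_nonneg fun p => ?_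
  simp only [mulOp_apply hh, real_inner_smul_right]
  exact mul_nonneg (hle p) real_inner_self_nonneg

lemma two_mul_abs_l2form_mulOp_le {u h : E → ℝ} (hu : u.HasTemperateGrowth)
    (hh : h.HasTemperateGrowth) (hle : ∀ p, |u p| ≤ h p) (f g : SchwartzMap E ℂ) :
    2 * |l2form μ g (mulOp u f)| ≤ l2form μ g (mulOp h g) + l2form μ f (mulOp h f) := by
  simp only [l2form_apply]
  rw [← integral_add (integrable_inner μ _ _) (integrable_inner μ _ _)]
  have h2 : (2 : ℝ) * |∫ p, inner ℝ (g p) (mulOp u f p) ∂μ| =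
      ‖∫ p, 2 * inner ℝ (g p) (mulOp u f p) ∂μ‖ := by
    rw [integral_const_mul, Real.norm_eq_abs, abs_mul, abs_two]
  rw [h2]
  refine norm_integral_le_of_norm_le
    ((integrable_inner μ _ _).add (integrable_inner μ _ _)) (.of_forall fun p => ?_)
  simp only [mulOp_apply hu, mulOp_apply hh, real_inner_smul_right, real_inner_self_eq_norm_sq,
    Real.norm_eq_abs, abs_mul, abs_two]
  have h1 := abs_real_inner_le_norm (g p) (f p)
  nlinarith [mul_le_mul (hle p) h1 (abs_nonneg _) ((abs_nonneg _).trans (hle p)),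
    mul_nonneg ((abs_nonneg _).trans (hle p)) (sq_nonneg (‖g p‖ - ‖f p‖))]

lemma two_mul_l2form_derivOp_mulOp {h h' : E → ℝ} {v : E} (hh : h.HasTemperateGrowth)
    (hh' : h'.HasTemperateGrowth) (hd : ∀ p, fderiv ℝ h p v = h' p) (f : SchwartzMap E ℂ) :
    2 * l2form μ (derivOp v f) (mulOp h f) = - l2form μ f (mulOp h' f) := by
  have h1 := l2form_derivOp μ v f (mulOp h f)
  have h2 := LinearMap.congr_fun (derivOp_mulOp hh hh' hd) f
  simp only [Module.End.mul_apply, LinearMap.add_apply] at h2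
  rw [h2, map_add, l2form_mulOp μ hh, l2form_symm μ (mulOp h f)] at h1
  linarith

namespace Slot

lemma form_Dst (s : Slot E) (m : Fin 4) (f g : SchwartzMap E ℂ) :
    l2form μ f (s.Dst m g) = l2form μ (s.D m f) g := by
  simp only [D, Dst, LinearMap.add_apply, LinearMap.neg_apply, map_add, map_neg,
    l2form_derivOp, l2form_mulOp μ (s.temperate m), neg_neg]

/-- The quadratic form `∑ₘ ‖D_m f‖²`. -/
def Q (s : Slot E) (f : SchwartzMap E ℂ) : ℝ := ∑ m, l2form μ (s.D m f) (s.D m f)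

lemma form_self_le_Q (s : Slot E) (f : SchwartzMap E ℂ) : l2form μ f f ≤ s.Q μ f := by
  have := Finset.single_le_sum (f := fun m => l2form μ (s.D m f) (s.D m f))
    (fun m _ => l2form_nonneg μ _) (Finset.mem_univ 0)
  simpa [s.D_zero, Q] using this

lemma Q_nonneg (s : Slot E) (f : SchwartzMap E ℂ) : 0 ≤ s.Q μ f :=
  (l2form_nonneg μ f).trans (s.form_self_le_Q μ f)

lemma sum_deriv_le_Q (s : Slot E) (f : SchwartzMap E ℂ) :
    ∑ m, l2form μ (derivOp (s.dir m) f) (derivOp (s.dir m) f) ≤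
      (1 + ∑ m, s.slope m) * s.Q μ f := by
  have h1 : ∀ m, l2form μ (derivOp (s.dir m) f) (derivOp (s.dir m) f) ≤
      l2form μ (s.D m f) (s.D m f) + s.slope m * l2form μ f f := by
    intro m
    have h2 := two_mul_l2form_derivOp_mulOp μ (s.temperate m) (.const (s.slope m))
      (s.fderiv_fn m) f
    have h3 : mulOp (fun _ : E => s.slope m) f = s.slope m • f := by
      refine SchwartzMap.ext fun p => ?_
      simp [mulOp_apply (HasTemperateGrowth.const (s.slope m))]
    rw [h3, map_smul, smul_eq_mul] at h2
    have h4 := l2form_nonneg μ (mulOp (s.fn m) f)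
    have h5 := l2form_symm μ (derivOp (s.dir m) f) (mulOp (s.fn m) f)
    simp only [D, LinearMap.add_apply, map_add]
    linarith
  have hA : 0 ≤ ∑ m, s.slope m := Finset.sum_nonneg fun m _ => s.slope_nonneg m
  calc _ ≤ ∑ m, (l2form μ (s.D m f) (s.D m f) + s.slope m * l2form μ f f) :=
        Finset.sum_le_sum fun m _ => h1 m
    _ = s.Q μ f + (∑ m, s.slope m) * l2form μ f f := by
        rw [Finset.sum_add_distrib, ← Finset.sum_mul, Q]
    _ ≤ _ := by nlinarith [s.form_self_le_Q μ f]

/-- Hardy's inequality for a weight dominated through a vector field. -/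
lemma hardy (s : Slot E) {F F' : Fin 4 → E → ℝ} {w : E → ℝ}
    (hF : ∀ m, (F m).HasTemperateGrowth) (hF' : ∀ m, (F' m).HasTemperateGrowth)
    (hd : ∀ m p, fderiv ℝ (F m) p (s.dir m) = F' m p) (hw : w.HasTemperateGrowth)
    (hle : ∀ p, w p ≤ 2 * ∑ m, F' m p - ∑ m, F m p ^ 2) (f : SchwartzMap E ℂ) :
    l2form μ f (mulOp w f) ≤ 4 * (1 + ∑ m, s.slope m) * s.Q μ f := by
  have h1 : ∀ m, l2form μ f (mulOp (F' m) f) ≤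
      2 * l2form μ (derivOp (s.dir m) f) (derivOp (s.dir m) f) +
      1 / 2 * l2form μ f (mulOp (fun p => F m p ^ 2) f) := by
    intro m
    have h2 := two_mul_l2form_derivOp_mulOp μ (hF m) (hF' m) (hd m) f
    have h3 := l2form_nonneg μ (derivOp (s.dir m) f + (1 / 2 : ℝ) • mulOp (F m) f)
    have h4 : l2form μ (mulOp (F m) f) (mulOp (F m) f) =
        l2form μ f (mulOp (fun p => F m p ^ 2) f) := by
      rw [← l2form_mulOp μ (hF m)]
      congr 1
      refine SchwartzMap.ext fun p => ?_
      rw [mulOp_apply (hF m), mulOp_apply (hF m), smul_smul, ← sq]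
      exact (mulOp_apply ((hF m).pow 2) f p).symm
    have h5 := l2form_symm μ (derivOp (s.dir m) f) (mulOp (F m) f)
    simp only [LinearMap.add_apply, map_add, map_smul, LinearMap.smul_apply, smul_eq_mul, h4]
      at h3
    linarith
  have h6 : mulOp (fun p => 2 * ∑ m, F' m p - ∑ m, F m p ^ 2) f =
      (2 : ℝ) • ∑ m, mulOp (F' m) f - ∑ m, mulOp (fun p => F m p ^ 2) f := by
    refine SchwartzMap.ext fun p => ?_
    have ht : HasTemperateGrowth (fun p => 2 * ∑ m, F' m p - ∑ m, F m p ^ 2) :=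
      ((HasTemperateGrowth.const 2).mul (.sum fun m _ => hF' m)).sub
        (.sum fun m _ => (hF m).pow 2)
    have e : ∀ m, mulOp (fun p => F m p ^ 2) f p = (F m p ^ 2) • f p :=
      fun m => mulOp_apply ((hF m).pow 2) f p
    rw [mulOp_apply ht]
    simp [mulOp_apply (hF' _), e, ← Finset.sum_mul]
    ring
  have h7 := l2form_mulOp_mono μ hw (((HasTemperateGrowth.const 2).mul
    (.sum fun m _ => hF' m)).sub (.sum fun m _ => (hF m).pow 2)) hle f
  have h8 := h7.trans_eq (congrArg (l2form μ f) h6)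
  simp only [map_sub, map_smul, map_sum, smul_eq_mul] at h8
  have h9 := Finset.sum_le_sum fun m (_ : m ∈ Finset.univ) => h1 m
  rw [Finset.sum_add_distrib, ← Finset.mul_sum, ← Finset.mul_sum] at h9
  linarith [s.sum_deriv_le_Q μ f]

lemma form_sum_mul (s : Slot E) (X : Module.End ℝ (SchwartzMap E ℂ)) (f : SchwartzMap E ℂ) :
    l2form μ f (((∑ m, s.Dst m * s.D m) * X) f) =
      ∑ m, l2form μ (s.D m f) (s.D m (X f)) := by
  simp [LinearMap.sum_apply, Module.End.mul_apply, form_Dst]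

lemma Indep.form_sum_mul_sum {s t : Slot E} (h : s.Indep t) (f : SchwartzMap E ℂ) :
    l2form μ f (((∑ m, s.Dst m * s.D m) * (∑ m, t.Dst m * t.D m)) f) =
      ∑ m, t.Q μ (s.D m f) := by
  rw [form_sum_mul]
  refine Finset.sum_congr rfl fun m _ => ?_
  have hc : Commute (s.D m) (∑ n, t.Dst n * t.D n) :=
    Commute.sum_right _ _ _ fun n _ => (h.commute_D_Dst m n).mul_right (h.commute_D_D m n)
  have h1 := LinearMap.congr_fun hc.eq f
  simp only [Module.End.mul_apply] at h1
  rw [h1]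
  simp [LinearMap.sum_apply, Module.End.mul_apply, form_Dst, Q]

lemma Indep.Q_le_sum {s t : Slot E} (f : SchwartzMap E ℂ) :
    t.Q μ f ≤ ∑ m, t.Q μ (s.D m f) := by
  have := Finset.single_le_sum (f := fun m => t.Q μ (s.D m f))
    (fun m _ => t.Q_nonneg μ _) (Finset.mem_univ 0)
  simpa [s.D_zero] using this

/-- A pair potential whose derivatives are dominated by a Hardy weight is controlled, after
multiplication by one of the one-particle operators, by the product of both. -/
lemma Indep.nonneg_single {s t : Slot E} (h : s.Indep t) {u w : E → ℝ} {u' : Fin 4 → E → ℝ}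
    {κ K : ℝ} (hK : 0 ≤ K) (hu : u.HasTemperateGrowth) (hu0 : ∀ p, 0 ≤ u p)
    (hw : w.HasTemperateGrowth) (hu' : ∀ m, (u' m).HasTemperateGrowth)
    (hd : ∀ m p, fderiv ℝ u p (s.dir m) = u' m p) (hle : ∀ m p, |u' m p| ≤ K * w p)
    (hardy : ∀ f, l2form μ f (mulOp w f) ≤ κ * t.Q μ f) (hκ : 0 ≤ κ) (f : SchwartzMap E ℂ) :
    0 ≤ l2form μ f (((∑ m, s.Dst m * s.D m) * mulOp u +
      (5 / 2 * κ * K) • ((∑ m, s.Dst m * s.D m) * (∑ m, t.Dst m * t.D m))) f) := by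
  rw [LinearMap.add_apply, LinearMap.smul_apply, map_add, map_smul, form_sum_mul,
    h.form_sum_mul_sum μ, smul_eq_mul]
  set T := ∑ m, t.Q μ (s.D m f) with hT
  have hQT : t.Q μ f ≤ T := Indep.Q_le_sum μ f
  have hKw : HasTemperateGrowth fun p => K * w p := (HasTemperateGrowth.const K).mul hw
  have hmul : ∀ g, l2form μ g (mulOp (fun p => K * w p) g) ≤ K * (κ * t.Q μ g) := by
    intro g
    have e : mulOp (fun p => K * w p) g = K • mulOp w g := by
      refine SchwartzMap.ext fun p => ?_
      rw [mulOp_apply hKw, _root_.smul_apply, mulOp_apply hw, smul_smul]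
    rw [e, map_smul, smul_eq_mul]
    exact mul_le_mul_of_nonneg_left (hardy g) hK
  have h1 : ∀ m, -(1 / 2 * (K * (κ * t.Q μ (s.D m f)) + K * (κ * T))) ≤
      l2form μ (s.D m f) (s.D m (mulOp u f)) := by
    intro m
    rw [s.D_mulOp hu (hu' m) m (hd m), map_add]
    have h2 := l2form_mulOp_nonneg μ hu hu0 (s.D m f)
    have h3 := two_mul_abs_l2form_mulOp_le μ (hu' m) hKw (hle m) f (s.D m f)
    have h4 := hmul (s.D m f)
    have h5 := hmul f
    have h6 : K * (κ * t.Q μ f) ≤ K * (κ * T) := by gcongr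
    have h7 := neg_abs_le (l2form μ (s.D m f) (mulOp (u' m) f))
    linarith
  have h8 := Finset.sum_le_sum fun m (_ : m ∈ Finset.univ) => h1 m
  have h9 : ∑ m, -(1 / 2 * (K * (κ * t.Q μ (s.D m f)) + K * (κ * T))) =
      -(5 / 2 * κ * K * T) := by
    rw [Finset.sum_neg_distrib, ← Finset.mul_sum, Finset.sum_add_distrib, ← Finset.mul_sum,
      ← Finset.mul_sum, ← hT, Finset.sum_const, Finset.card_univ, Fintype.card_fin]
    simp only [nsmul_eq_mul]
    push_cast
    ring
  linarith

/-- A pair potential with bounded first and mixed second derivatives is controlled, after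
multiplication by both one-particle operators, by the product of both. -/
lemma Indep.nonneg_both {s t : Slot E} (h : s.Indep t) {u : E → ℝ} {us ut : Fin 4 → E → ℝ}
    {ust : Fin 4 → Fin 4 → E → ℝ} {K : ℝ} (hu : u.HasTemperateGrowth)
    (hu0 : ∀ p, 0 ≤ u p) (hus : ∀ m, (us m).HasTemperateGrowth)
    (hut : ∀ m, (ut m).HasTemperateGrowth) (hust : ∀ m n, (ust m n).HasTemperateGrowth)
    (hds : ∀ m p, fderiv ℝ u p (s.dir m) = us m p)
    (hdt : ∀ m p, fderiv ℝ u p (t.dir m) = ut m p)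
    (hdst : ∀ m n p, fderiv ℝ (us m) p (t.dir n) = ust m n p)
    (hles : ∀ m p, |us m p| ≤ K) (hlet : ∀ m p, |ut m p| ≤ K)
    (hlest : ∀ m n p, |ust m n p| ≤ K) (f : SchwartzMap E ℂ) :
    0 ≤ l2form μ f (((∑ m, s.Dst m * s.D m) * ((∑ m, t.Dst m * t.D m) * mulOp u) +
      (48 * K) • ((∑ m, s.Dst m * s.D m) * (∑ m, t.Dst m * t.D m))) f) := by
  have hK : 0 ≤ K := (abs_nonneg _).trans (hles 0 0)
  rw [LinearMap.add_apply, LinearMap.smul_apply, map_add, map_smul, ← mul_assoc,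
    h.form_sum_mul_sum μ, smul_eq_mul]
  have hX : l2form μ f (((∑ m, s.Dst m * s.D m) * (∑ m, t.Dst m * t.D m) * mulOp u) f) =
      ∑ m, ∑ n, l2form μ (t.D n (s.D m f)) (t.D n (s.D m (mulOp u f))) := by
    rw [mul_assoc, form_sum_mul]
    refine Finset.sum_congr rfl fun m _ => ?_
    have hc : Commute (s.D m) (∑ n, t.Dst n * t.D n) :=
      Commute.sum_right _ _ _ fun n _ => (h.commute_D_Dst m n).mul_right (h.commute_D_D m n)
    have h1 := LinearMap.congr_fun hc.eq (mulOp u f)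
    simp only [Module.End.mul_apply] at h1
    rw [Module.End.mul_apply, h1]
    simp [LinearMap.sum_apply, Module.End.mul_apply, form_Dst]
  rw [hX]
  set T := ∑ m, t.Q μ (s.D m f) with hT
  have hmn : ∀ m n, l2form μ (t.D n (s.D m f)) (t.D n (s.D m f)) ≤ T := by
    intro m n
    refine (Finset.single_le_sum (f := fun n => l2form μ (t.D n (s.D m f)) (t.D n (s.D m f)))
      (fun n _ => l2form_nonneg μ _) (Finset.mem_univ n)).trans ?_
    exact Finset.single_le_sum (f := fun m => t.Q μ (s.D m f))
      (fun m _ => t.Q_nonneg μ _) (Finset.mem_univ m)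
  have hm : ∀ m, l2form μ (s.D m f) (s.D m f) ≤ T := fun m => by
    simpa [t.D_zero] using hmn m 0
  have hn : ∀ n, l2form μ (t.D n f) (t.D n f) ≤ T := fun n => by
    simpa [s.D_zero] using hmn 0 n
  have h0 : l2form μ f f ≤ T := by simpa [s.D_zero] using hm 0
  have herr : ∀ (v : E → ℝ) (g : SchwartzMap E ℂ) (g' : SchwartzMap E ℂ),
      v.HasTemperateGrowth → (∀ p, |v p| ≤ K) → l2form μ g g ≤ T → l2form μ g' g' ≤ T →
      -(K * T) ≤ l2form μ g (mulOp v g') := by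
    intro v g g' hv hvK hg hg'
    have h1 := two_mul_abs_l2form_mulOp_le μ hv (.const K) hvK g' g
    have e : ∀ g, mulOp (fun _ : E => K) g = K • g := fun g => by
      refine SchwartzMap.ext fun p => ?_
      simp [mulOp_apply (HasTemperateGrowth.const K)]
    simp only [e, map_smul, smul_eq_mul] at h1
    have h2 := neg_abs_le (l2form μ g (mulOp v g'))
    nlinarith [mul_le_mul_of_nonneg_left hg hK, mul_le_mul_of_nonneg_left hg' hK]
  have h1 : ∀ m n, -(3 * (K * T)) ≤
      l2form μ (t.D n (s.D m f)) (t.D n (s.D m (mulOp u f))) := by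
    intro m n
    rw [s.D_mulOp hu (hus m) m (hds m), map_add, t.D_mulOp hu (hut n) n (hdt n),
      t.D_mulOp (hus m) (hust m n) n (hdst m n), map_add, map_add, map_add]
    have h2 := l2form_mulOp_nonneg μ hu hu0 (t.D n (s.D m f))
    have h3 := herr (ut n) _ _ (hut n) (hlet n) (hmn m n) (hm m)
    have h4 := herr (us m) _ _ (hus m) (hles m) (hmn m n) (hn n)
    have h5 := herr (ust m n) _ _ (hust m n) (hlest m n) (hmn m n) h0
    linarith
  have h8 := Finset.sum_le_sum fun m (_ : m ∈ Finset.univ) =>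
    Finset.sum_le_sum fun n (_ : n ∈ Finset.univ) => h1 m n
  simp only [Finset.sum_const, Finset.card_univ, Fintype.card_fin, nsmul_eq_mul] at h8
  push_cast at h8
  linarith

end Slot

end SchwartzOp

/-! ### The Hardy weight on `ℝ³` -/

namespace Weight

open SchwartzMap LineDeriv Function

/-- The coordinate directions, preceded by zero. -/
def e : Fin 4 → R3 := ![0, ex0, ex1, ez]

/-- The coordinates, preceded by zero. -/
def ξ : Fin 4 → R3 →L[ℝ] ℝ :=
  ![0, (EuclideanSpace.proj 0).comp (.fst ℝ R2 ℝ), (EuclideanSpace.proj 1).comp (.fst ℝ R2 ℝ),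
    .snd ℝ R2 ℝ]

/-- The square of the Euclidean norm. -/
def q (r : R3) : ℝ := ∑ m, ξ m r ^ 2

/-- The weight `1 / (1 + |r|²)`. -/
def ρ (r : R3) : ℝ := (1 + q r)⁻¹

lemma q_nonneg (r : R3) : 0 ≤ q r := Finset.sum_nonneg fun _ _ => sq_nonneg _

lemma one_add_q_pos (r : R3) : 0 < 1 + q r := by linarith [q_nonneg r]

lemma ρ_pos (r : R3) : 0 < ρ r := inv_pos.2 (one_add_q_pos r)

lemma ρ_mul (r : R3) : ρ r * (1 + q r) = 1 := inv_mul_cancel₀ (one_add_q_pos r).ne'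

lemma sum_ξ_mul (r : R3) (m : Fin 4) : ∑ n, ξ n r * ξ n (e m) = ξ m r := by
  fin_cases m <;> simp [Fin.sum_univ_four, ξ, e, ex0, ex1, ez]

lemma sum_ξ_e : ∑ m, ξ m (e m) = 3 := by
  simp [Fin.sum_univ_four, ξ, e, ex0, ex1, ez]
  norm_num

lemma hasTemperateGrowth_ρ : HasTemperateGrowth ρ := by
  let L : R3 →L[ℝ] EuclideanSpace ℝ (Fin 4) :=
    (EuclideanSpace.equiv (Fin 4) ℝ).symm.toContinuousLinearMap.comp (.pi ξ)
  have h := (hasTemperateGrowth_one_add_norm_sq_rpow (EuclideanSpace ℝ (Fin 4)) (-1)).comp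
    L.hasTemperateGrowth
  have hρ : ρ = (fun x => (1 + ‖x‖ ^ 2) ^ (-1 : ℝ)) ∘ L := by
    funext r
    simp only [Function.comp, EuclideanSpace.norm_sq_eq, Real.rpow_neg_one, ρ, q]
    simp [L]
  rwa [hρ]

lemma hasFDerivAt_ρ (r : R3) :
    HasFDerivAt ρ (-(ρ r ^ 2) • ∑ n, (2 * ξ n r) • ξ n) r := by
  have h1 : HasFDerivAt (fun r => 1 + q r) (∑ n, (2 * ξ n r) • ξ n) r := by
    refine HasFDerivAt.const_add _ (HasFDerivAt.fun_sum fun n _ => ?_)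
    simpa using (ξ n).hasFDerivAt.pow 2
  have h2 := (hasDerivAt_inv (one_add_q_pos r).ne').comp_hasFDerivAt r h1
  refine h2.congr_fderiv ?_
  simp only [ρ, inv_pow]

/-- The components of the vector field `r / (1 + |r|²)`. -/
def φ (m : Fin 4) (r : R3) : ℝ := ξ m r * ρ r

/-- The diagonal derivatives of the vector field `r / (1 + |r|²)`. -/
def φ' (m : Fin 4) (r : R3) : ℝ := ξ m (e m) * ρ r - 2 * (ξ m r * ρ r) ^ 2

lemma hasTemperateGrowth_φ (m : Fin 4) : HasTemperateGrowth (φ m) :=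
  (ξ m).hasTemperateGrowth.mul hasTemperateGrowth_ρ

lemma hasTemperateGrowth_φ' (m : Fin 4) : HasTemperateGrowth (φ' m) :=
  ((HasTemperateGrowth.const _).mul hasTemperateGrowth_ρ).sub
    ((HasTemperateGrowth.const 2).mul ((hasTemperateGrowth_φ m).pow 2))

lemma fderiv_φ (m : Fin 4) (r : R3) : fderiv ℝ (φ m) r (e m) = φ' m r := by
  have h := ((ξ m).hasFDerivAt (x := r)).mul (hasFDerivAt_ρ r)
  have h1 : ∑ n, 2 * ξ n r * ξ n (e m) = 2 * ξ m r := by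
    rw [← sum_ξ_mul r m, Finset.mul_sum]
    exact Finset.sum_congr rfl fun n _ => by ring
  have h2 : fderiv ℝ (φ m) r = _ := h.fderiv
  rw [h2]
  simp only [_root_.add_apply, _root_.smul_apply, _root_.sum_apply, smul_eq_mul, h1, φ']
  ring

lemma ρ_le_sum (r : R3) : ρ r ≤ 2 * ∑ m, φ' m r - ∑ m, φ m r ^ 2 := by
  have h1 : ∑ m, φ' m r = 3 * ρ r - 2 * (q r * ρ r ^ 2) := by
    simp only [φ', Finset.sum_sub_distrib, ← Finset.sum_mul, ← Finset.mul_sum, sum_ξ_e, mul_pow]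
    rfl
  have h2 : ∑ m, φ m r ^ 2 = q r * ρ r ^ 2 := by
    simp only [φ, mul_pow, ← Finset.sum_mul]
    rfl
  rw [h1, h2]
  have h3 : q r * ρ r ^ 2 = ρ r - ρ r ^ 2 := by
    linear_combination ρ r * ρ_mul r
  rw [h3]
  nlinarith [sq_nonneg (ρ r)]

lemma exists_bound_ρ (g : SchwartzMap R3 ℝ) : ∃ C, 0 ≤ C ∧ ∀ r, |g r| ≤ C * ρ r := by
  obtain ⟨C₀, -, h₀⟩ := g.decay 0 0
  obtain ⟨C₂, -, h₂⟩ := g.decay 2 0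
  simp only [norm_iteratedFDeriv_zero, pow_zero, one_mul, Real.norm_eq_abs] at h₀ h₂
  have hq : ∀ r, q r ≤ (∑ m, ‖ξ m‖ ^ 2) * ‖r‖ ^ 2 := by
    intro r
    rw [Finset.sum_mul]
    refine Finset.sum_le_sum fun m _ => ?_
    rw [← mul_pow, ← sq_abs]
    exact pow_le_pow_left₀ (abs_nonneg _) ((ξ m).le_opNorm r) 2
  have hb : ∀ r, |g r| ≤ (C₀ + (∑ m, ‖ξ m‖ ^ 2) * C₂) * ρ r := by
    intro r
    have hs : 0 ≤ ∑ m, ‖ξ m‖ ^ 2 := Finset.sum_nonneg fun _ _ => sq_nonneg _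
    rw [ρ, ← div_eq_mul_inv, le_div_iff₀ (one_add_q_pos r)]
    have h1 := mul_le_mul_of_nonneg_left (h₂ r) hs
    have h2 := mul_le_mul_of_nonneg_right (hq r) (abs_nonneg (g r))
    linarith [h₀ r]
  refine ⟨_, ?_, hb⟩
  have := (abs_nonneg _).trans (hb 0)
  exact nonneg_of_mul_nonneg_left this (ρ_pos 0)

lemma ρ_le_one (r : R3) : ρ r ≤ 1 := inv_le_one_of_one_le₀ (by linarith [q_nonneg r])

end Weight

/-! ### Pair potentials -/

namespace SchwartzOp

open SchwartzMap LineDeriv Function Weight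

variable {E : Type*} [NormedAddCommGroup E] [NormedSpace ℝ E]

lemma fderiv_const_mul_comp {g : R3 → ℝ} (hg : Differentiable ℝ g) (Λ : E →L[ℝ] R3) (A : ℝ)
    {d : E} {c : ℝ} {v : R3} (hd : Λ d = c • v) (p : E) :
    fderiv ℝ (fun p => A * g (Λ p)) p d = A * c * fderiv ℝ g (Λ p) v := by
  have h := (((hg (Λ p)).hasFDerivAt.comp p Λ.hasFDerivAt).const_mul A).fderiv
  have h' : fderiv ℝ (fun p => A * g (Λ p)) p = A • (fderiv ℝ g (Λ p)).comp Λ := h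
  rw [h']
  simp [hd, mul_assoc]

lemma hasTemperateGrowth_const_mul_comp {g : R3 → ℝ} (hg : g.HasTemperateGrowth)
    (Λ : E →L[ℝ] R3) (A : ℝ) : HasTemperateGrowth fun p => A * g (Λ p) :=
  (HasTemperateGrowth.const A).mul (hg.comp Λ.hasTemperateGrowth)

variable [MeasurableSpace E] [BorelSpace E] [FiniteDimensional ℝ E]
  (μ : Measure E) [μ.IsAddHaarMeasure]

lemma Slot.hardy_comp (t : Slot E) (Λ : E →L[ℝ] R3) {τ : ℝ}
    (hΛ : ∀ m, Λ (t.dir m) = τ • e m) (f : SchwartzMap E ℂ) :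
    l2form μ f (mulOp (fun p => τ ^ 2 * ρ (Λ p)) f) ≤
      4 * (1 + ∑ m, t.slope m) * t.Q μ f := by
  refine t.hardy μ (F := fun m p => τ * φ m (Λ p)) (F' := fun m p => τ * τ * φ' m (Λ p))
    (fun m => hasTemperateGrowth_const_mul_comp (hasTemperateGrowth_φ m) Λ _)
    (fun m => hasTemperateGrowth_const_mul_comp (hasTemperateGrowth_φ' m) Λ _)
    (fun m p => ?_) (hasTemperateGrowth_const_mul_comp hasTemperateGrowth_ρ Λ _) (fun p => ?_) f
  · rw [fderiv_const_mul_comp ((hasTemperateGrowth_φ m).1.differentiable (by simp)) Λ τ (hΛ m),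
      fderiv_φ]
  · have h := mul_le_mul_of_nonneg_left (ρ_le_sum (Λ p)) (sq_nonneg τ)
    simp only [mul_pow, ← Finset.mul_sum]
    linarith

variable {s t : Slot E} (h : s.Indep t) (V : SchwartzMap R3 ℝ) (hV : ∀ r, 0 ≤ V r)
  {Λ : E →L[ℝ] R3} {A a C σ τ : ℝ} (hA : 0 ≤ A) (ha : 0 < a) (hσ : |σ| = a) (hτ : |τ| = a)
  (hsΛ : ∀ m, Λ (s.dir m) = σ • e m) (htΛ : ∀ m, Λ (t.dir m) = τ • e m)
include h hV hA ha hσ hτ hsΛ htΛ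

lemma Slot.Indep.nonneg_potential_single (hC : 0 ≤ C)
    (hVC : ∀ m r, |fderiv ℝ V r (e m)| ≤ C * ρ r) (f : SchwartzMap E ℂ) :
    0 ≤ l2form μ f (((∑ m, s.Dst m * s.D m) * mulOp (fun p => A * V (Λ p)) +
      (5 / 2 * (4 * (1 + ∑ m, t.slope m)) * (A * C / a)) •
        ((∑ m, s.Dst m * s.D m) * (∑ m, t.Dst m * t.D m))) f) := by
  have hV' : ∀ m r, (∂_{e m} V) r = fderiv ℝ V r (e m) := fun m r =>
    lineDerivOp_apply_eq_fderiv (e m) V r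
  have hs : 0 ≤ ∑ m, t.slope m := Finset.sum_nonneg fun m _ => t.slope_nonneg m
  refine h.nonneg_single μ (w := fun p => τ ^ 2 * ρ (Λ p))
    (u' := fun m p => A * σ * (∂_{e m} V) (Λ p)) (by positivity)
    (hasTemperateGrowth_const_mul_comp V.hasTemperateGrowth Λ A)
    (fun p => mul_nonneg hA (hV _)) (hasTemperateGrowth_const_mul_comp hasTemperateGrowth_ρ Λ _)
    (fun m => hasTemperateGrowth_const_mul_comp (∂_{e m} V).hasTemperateGrowth Λ _)
    (fun m p => ?_) (fun m p => ?_) (t.hardy_comp μ Λ htΛ) (by positivity) f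
  · rw [fderiv_const_mul_comp V.differentiable Λ A (hsΛ m), hV']
  · rw [hV', abs_mul, abs_mul, hσ, abs_of_nonneg hA, ← sq_abs τ, hτ]
    calc A * a * |fderiv ℝ V (Λ p) (e m)| ≤ A * a * (C * ρ (Λ p)) := by
          gcongr
          exact hVC m _
      _ = A * C / a * (a ^ 2 * ρ (Λ p)) := by field_simp

lemma Slot.Indep.nonneg_potential_both (ha1 : 1 ≤ a)
    (hVC : ∀ m r, |fderiv ℝ V r (e m)| ≤ C)
    (hVC' : ∀ m n r, |fderiv ℝ (fun r => fderiv ℝ V r (e m)) r (e n)| ≤ C)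
    (f : SchwartzMap E ℂ) :
    0 ≤ l2form μ f (((∑ m, s.Dst m * s.D m) * ((∑ m, t.Dst m * t.D m) *
      mulOp (fun p => A * V (Λ p))) + (48 * (A * a ^ 2 * C)) •
        ((∑ m, s.Dst m * s.D m) * (∑ m, t.Dst m * t.D m))) f) := by
  have hV' : ∀ m, ⇑(∂_{e m} V : SchwartzMap R3 ℝ) = fun r => fderiv ℝ V r (e m) := fun m =>
    funext fun r => lineDerivOp_apply_eq_fderiv (e m) V r
  have hV'' : ∀ m n r, (∂_{e n} (∂_{e m} V)) r =
      fderiv ℝ (fun r => fderiv ℝ V r (e m)) r (e n) := fun m n r => by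
    rw [lineDerivOp_apply_eq_fderiv, hV']
  have hC : 0 ≤ C := (abs_nonneg _).trans (hVC 0 0)
  have haa : a ≤ a ^ 2 := by nlinarith
  have h1 : ∀ (m : Fin 4) (κ : ℝ) (p : E), |κ| = a → |A * κ * (∂_{e m} V) (Λ p)| ≤
      A * a ^ 2 * C := by
    intro m κ p hκ
    rw [abs_mul, abs_mul, hκ, abs_of_nonneg hA, hV']
    have := hVC m (Λ p)
    gcongr
  refine h.nonneg_both μ (us := fun m p => A * σ * (∂_{e m} V) (Λ p))
    (ut := fun m p => A * τ * (∂_{e m} V) (Λ p))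
    (ust := fun m n p => A * σ * τ * (∂_{e n} (∂_{e m} V)) (Λ p))
    (hasTemperateGrowth_const_mul_comp V.hasTemperateGrowth Λ A)
    (fun p => mul_nonneg hA (hV _))
    (fun m => hasTemperateGrowth_const_mul_comp (∂_{e m} V).hasTemperateGrowth Λ _)
    (fun m => hasTemperateGrowth_const_mul_comp (∂_{e m} V).hasTemperateGrowth Λ _)
    (fun m n => hasTemperateGrowth_const_mul_comp (∂_{e n} (∂_{e m} V)).hasTemperateGrowth Λ _)
    (fun m p => ?_) (fun m p => ?_) (fun m n p => ?_) (fun m p => h1 m σ p hσ)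
    (fun m p => h1 m τ p hτ) (fun m n p => ?_) f
  · rw [fderiv_const_mul_comp V.differentiable Λ A (hsΛ m), hV']
  · rw [fderiv_const_mul_comp V.differentiable Λ A (htΛ m), hV']
  · rw [fderiv_const_mul_comp (∂_{e m} V).differentiable Λ _ (htΛ n),
      lineDerivOp_apply_eq_fderiv (e n)]
  · rw [abs_mul, abs_mul, abs_mul, hσ, hτ, abs_of_nonneg hA, hV'', mul_assoc A, ← sq]
    have := hVC' m n (Λ p)
    gcongr

end SchwartzOp

/-! ### The concrete many-body system -/

namespace Concrete

open SchwartzMap Function Weight SchwartzOp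

instance (N : ℕ) : (volume : Measure (RN N)).IsAddHaarMeasure := by
  have : (volume : Measure R3).IsAddHaarMeasure :=
    inferInstanceAs ((volume : Measure R2).prod (volume : Measure ℝ)).IsAddHaarMeasure
  exact Measure.pi.isAddHaarMeasure _

variable {N : ℕ}

lemma dirN_apply (j i : Fin N) (v : R3) : dirN N j v i = if i = j then v else 0 := by
  simp [dirN, Fin.ext_iff]

/-- The height of the `j`-th particle. -/
def height (j : Fin N) : RN N →L[ℝ] ℝ := (ContinuousLinearMap.snd ℝ R2 ℝ).comp (.proj j)

/-- The separation of two particles, rescaled. -/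
def separation (a : ℝ) (i l : Fin N) : RN N →L[ℝ] R3 :=
  a • (ContinuousLinearMap.proj (R := ℝ) (φ := fun _ : Fin N => R3) i - .proj l)

lemma separation_apply (a : ℝ) (i l : Fin N) (p : RN N) :
    separation a i l p = a • (p i - p l) := by
  simp [separation]

lemma separation_left (a : ℝ) {i l : Fin N} (h : i ≠ l) (v : R3) :
    separation a i l (dirN N i v) = a • v := by
  simp [separation_apply, dirN_apply, h.symm]

lemma separation_right (a : ℝ) {i l : Fin N} (h : i ≠ l) (v : R3) :
    separation a i l (dirN N l v) = (-a) • v := by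
  simp [separation_apply, dirN_apply, h]

lemma separation_other (a : ℝ) {i l j : Fin N} (hi : j ≠ i) (hl : j ≠ l) (v : R3) :
    separation a i l (dirN N j v) = (0 : ℝ) • v := by
  simp [separation_apply, dirN_apply, hi.symm, hl.symm]

/-- The zeroth order coefficients of the first order operators in slot `j`. -/
def slotFn (ω : ℝ) (j : Fin N) : Fin 4 → RN N → ℝ :=
  ![fun _ => 1, fun _ => 0, fun _ => 0, fun p => (ω • height j) p]

lemma fderiv_slotFn (ω : ℝ) (j : Fin N) (m : Fin 4) (p v : RN N) :
    fderiv ℝ (slotFn ω j m) p v = ![0, 0, 0, ω * (v j).2] m := by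
  have h : fderiv ℝ (fun p => (ω • height j) p) p = ω • height j :=
    (ω • height j).hasFDerivAt.fderiv
  fin_cases m <;> simp only [slotFn] <;> simp
  simpa [height] using congrArg (fun L : RN N →L[ℝ] ℝ => L v) h

/-- The first order operators of the `j`-th particle. -/
def slot {ω : ℝ} (hω : 0 ≤ ω) (j : Fin N) : Slot (RN N) where
  dir m := dirN N j (e m)
  fn := slotFn ω j
  temperate m := by
    have h := (ω • height j).hasTemperateGrowth
    fin_cases m
    exacts [.const _, .const _, .const _, h]
  slope := ![0, 0, 0, ω]
  fderiv_fn m p := by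
    rw [fderiv_slotFn]
    fin_cases m <;> simp [dirN_apply, e, ez]
  slope_nonneg m := by fin_cases m <;> simp [hω]
  dir_zero := by
    ext i : 1
    simp [dirN_apply, e]
  fn_zero := rfl

lemma slot_indep {ω : ℝ} (hω : 0 ≤ ω) {i j : Fin N} (h : i ≠ j) :
    (slot hω i).Indep (slot hω j) := by
  refine ⟨fun m n p => ?_, fun m n p => ?_⟩
  · have := fderiv_slotFn ω i m p (dirN N j (e n))
    refine this.trans ?_
    fin_cases m <;> simp [dirN_apply, h]
  · have := fderiv_slotFn ω j n p (dirN N i (e m))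
    refine this.trans ?_
    fin_cases n <;> simp [dirN_apply, h.symm]

lemma sum_slope {ω : ℝ} (hω : 0 ≤ ω) (j : Fin N) : ∑ m, (slot hω j).slope m = ω := by
  simp [slot, Fin.sum_univ_four]

/-- A bound for the first two derivatives of a potential. -/
structure PotentialBound (V : SchwartzMap R3 ℝ) (C : ℝ) : Prop where
  nonneg : 0 ≤ C
  weight : ∀ m r, |fderiv ℝ V r (e m)| ≤ C * ρ r
  second : ∀ m n r, |fderiv ℝ (fun r => fderiv ℝ V r (e m)) r (e n)| ≤ C

lemma exists_potentialBound (V : SchwartzMap R3 ℝ) : ∃ C, PotentialBound V C := by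
  choose C hC0 hC using fun m => exists_bound_ρ (LineDeriv.lineDerivOp (e m) V)
  choose C' hC0' hC' using fun m n =>
    exists_bound_ρ (LineDeriv.lineDerivOp (e n) (LineDeriv.lineDerivOp (e m) V))
  have h1 : ∀ m, C m ≤ ∑ m, C m := fun m =>
    Finset.single_le_sum (fun m _ => hC0 m) (Finset.mem_univ m)
  have h2 : ∀ m n, C' m n ≤ ∑ m, ∑ n, C' m n := fun m n =>
    (Finset.single_le_sum (f := fun n => C' m n) (fun n _ => hC0' m n)
      (Finset.mem_univ n)).trans
      (Finset.single_le_sum (f := fun m => ∑ n, C' m n)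
        (fun m _ => Finset.sum_nonneg fun n _ => hC0' m n) (Finset.mem_univ m))
  have h3 : 0 ≤ ∑ m, C m := Finset.sum_nonneg fun m _ => hC0 m
  have h4 : 0 ≤ ∑ m, ∑ n, C' m n :=
    Finset.sum_nonneg fun m _ => Finset.sum_nonneg fun n _ => hC0' m n
  refine ⟨∑ m, C m + ∑ m, ∑ n, C' m n, add_nonneg h3 h4, fun m r => ?_, fun m n r => ?_⟩
  · rw [← lineDerivOp_apply_eq_fderiv]
    exact (hC m r).trans (mul_le_mul_of_nonneg_right (by linarith [h1 m]) (ρ_pos r).le)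
  · have hV : (fun r => fderiv ℝ V r (e m)) = ⇑(LineDeriv.lineDerivOp (e m) V) :=
      funext fun r => (lineDerivOp_apply_eq_fderiv (e m) V r).symm
    rw [hV, ← lineDerivOp_apply_eq_fderiv]
    refine (hC' m n r).trans ((mul_le_of_le_one_right (hC0' m n) (ρ_le_one r)).trans ?_)
    linarith [h2 m n]

section Bounds

variable {ω : ℝ} (hω : 0 ≤ ω) {V : SchwartzMap R3 ℝ} (hV : ∀ r, 0 ≤ V r) {C : ℝ}
  (hC : PotentialBound V C) {A a : ℝ} (hA : 0 ≤ A) (ha : 1 ≤ a) {i l : Fin N} (h : i ≠ l)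
  (f : SchwartzMap (RN N) ℂ)
include hV hC hA ha h

lemma nonneg_left :
    0 ≤ l2form volume f (((∑ m, (slot hω i).Dst m * (slot hω i).D m) *
      mulOp (fun p => A * V (separation a i l p)) +
      (5 / 2 * (4 * (1 + ω)) * (A * C / a)) • ((∑ m, (slot hω i).Dst m * (slot hω i).D m) *
        (∑ m, (slot hω l).Dst m * (slot hω l).D m))) f) := by
  have := (slot_indep hω h).nonneg_potential_single volume V hV (Λ := separation a i l) hA
    (by linarith : 0 < a) (abs_of_nonneg (by linarith)) (τ := -a)
    (by rw [abs_neg, abs_of_nonneg (by linarith)]) (fun m => separation_left a h (e m))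
    (fun m => separation_right a h (e m)) hC.nonneg hC.weight f
  rwa [sum_slope] at this

lemma nonneg_right :
    0 ≤ l2form volume f (((∑ m, (slot hω l).Dst m * (slot hω l).D m) *
      mulOp (fun p => A * V (separation a i l p)) +
      (5 / 2 * (4 * (1 + ω)) * (A * C / a)) • ((∑ m, (slot hω l).Dst m * (slot hω l).D m) *
        (∑ m, (slot hω i).Dst m * (slot hω i).D m))) f) := by
  have := (slot_indep hω h.symm).nonneg_potential_single volume V hV (Λ := separation a i l)
    hA (by linarith : 0 < a) (σ := -a) (by rw [abs_neg, abs_of_nonneg (by linarith)])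
    (abs_of_nonneg (by linarith)) (fun m => separation_right a h (e m))
    (fun m => separation_left a h (e m)) hC.nonneg hC.weight f
  rwa [sum_slope] at this

lemma nonneg_both :
    0 ≤ l2form volume f (((∑ m, (slot hω i).Dst m * (slot hω i).D m) *
      ((∑ m, (slot hω l).Dst m * (slot hω l).D m) *
        mulOp (fun p => A * V (separation a i l p))) +
      (48 * (A * a ^ 2 * C)) • ((∑ m, (slot hω i).Dst m * (slot hω i).D m) *
        (∑ m, (slot hω l).Dst m * (slot hω l).D m))) f) := by
  have ha0 : 0 < a := by linarith
  have h1 : |a| = a := abs_of_pos ha0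
  have h2 : |(-a)| = a := by rw [abs_neg, h1]
  have h3 : ∀ m r, |fderiv ℝ V r (e m)| ≤ C := fun m r =>
    (hC.weight m r).trans (mul_le_of_le_one_right hC.nonneg (ρ_le_one r))
  have := (slot_indep hω h).nonneg_potential_both volume V hV (Λ := separation a i l) hA ha0
    (σ := a) (τ := -a) h1 h2 (fun m => separation_left a h (e m))
    (fun m => separation_right a h (e m)) ha h3 hC.second f
  convert this using 1

end Bounds

/-- The many-body system with interaction `A V(a (r_i - r_l))` and coupling constant `c`. -/
def system {ω : ℝ} (hω : 0 ≤ ω) {V : SchwartzMap R3 ℝ} (hV : ∀ r, 0 ≤ V r) {C : ℝ}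
    (hC : PotentialBound V C) {A a c : ℝ} (hA : 0 ≤ A) (ha : 1 ≤ a) (hc : 0 ≤ c) :
    ManyBodySystem N (SchwartzMap (RN N) ℂ) where
  form := l2form volume
  form_symm := l2form_symm volume
  form_nonneg := l2form_nonneg volume
  D j := (slot hω j).D
  Dst j := (slot hω j).Dst
  form_Dst j := (slot hω j).form_Dst volume
  D_zero j := (slot hω j).D_zero
  comm_D_D i j m n h := (slot_indep hω h).commute_D_D m n
  comm_D_Dst i j m n h := (slot_indep hω h).commute_D_Dst m n
  comm_Dst_Dst i j m n h := (slot_indep hω h).commute_Dst_Dst m n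
  V i l := mulOp fun p => A * V (separation a i l p)
  form_V i l := l2form_mulOp volume
    (hasTemperateGrowth_const_mul_comp V.hasTemperateGrowth _ A)
  V_nonneg i l := l2form_mulOp_nonneg volume
    (hasTemperateGrowth_const_mul_comp V.hasTemperateGrowth _ A) fun _ => mul_nonneg hA (hV _)
  comm_D_V j m i l hi hl := (slot hω j).commute_D_mulOp
    (hasTemperateGrowth_const_mul_comp V.hasTemperateGrowth _ A) m fun p =>
      (fderiv_const_mul_comp V.differentiable _ A (separation_other a hi hl (e m)) p).trans
        (by simp)
  b₁ := 5 / 2 * (4 * (1 + ω)) * (A * C / a)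
  b₂ := 48 * (A * a ^ 2 * C)
  b₁_nonneg := by
    have := hC.nonneg
    positivity
  b₂_nonneg := by
    have := hC.nonneg
    positivity
  bound_left i l h f := nonneg_left hω hV hC hA ha h f
  bound_right i l h f := nonneg_right hω hV hC hA ha h f
  bound_both i l h f := nonneg_both hω hV hC hA ha h f
  c := c
  c_nonneg := hc

/-- The one-particle operator in explicit form. -/
lemma sum_Dst_D_apply {ω : ℝ} (hω : 0 ≤ ω) (j : Fin N) (f : SchwartzMap (RN N) ℂ) :
    ⇑((∑ m, (slot hω j).Dst m * (slot hω j).D m) f) = S2j N ω j f := by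
  have hm : ∀ m p, (((slot hω j).Dst m * (slot hω j).D m) f) p =
      -pd2 (dirN N j (e m)) f p + (((slot hω j).fn m p ^ 2 - (slot hω j).slope m : ℝ) : ℂ) * f p := by
    intro m p
    have hd := derivOp_mulOp ((slot hω j).temperate m) (.const ((slot hω j).slope m))
      ((slot hω j).fderiv_fn m)
    have hd' := DFunLike.congr_fun (LinearMap.congr_fun hd f) p
    have h2 : derivOp ((slot hω j).dir m) (derivOp ((slot hω j).dir m) f) p =
        pd2 (dirN N j (e m)) f p := by
      rw [derivOp_apply]
      exact congrArg (fun g => fderiv ℝ g p (dirN N j (e m))) (funext fun q => derivOp_apply _ f q)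
    have ht := (slot hω j).temperate m
    simp only [Module.End.mul_apply, LinearMap.add_apply, _root_.add_apply, mulOp_apply ht,
      mulOp_apply (.const ((slot hω j).slope m))] at hd'
    simp only [Slot.Dst, Slot.D, Module.End.mul_apply, LinearMap.add_apply, _root_.add_apply,
      LinearMap.neg_apply, map_add, _root_.neg_apply, mulOp_apply ht, hd']
    rw [h2]
    simp only [Complex.real_smul]
    push_cast
    ring
  have h0 : ∀ p, pd2 (dirN N j (0 : R3)) f p = 0 := fun p => by
    have : dirN N j (0 : R3) = 0 := by
      ext i : 1
      simp [dirN]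
    simp [pd2, pd, this]
  funext p
  rw [LinearMap.sum_apply, _root_.sum_apply]
  simp only [hm, Fin.sum_univ_four]
  simp [h0, e, slotFn, slot, S2j, lapj, coordZ, height]
  ring

section System

variable {ω : ℝ} (hω : 0 ≤ ω) {V : SchwartzMap R3 ℝ} (hV : ∀ r, 0 ≤ V r) {C : ℝ}
  (hC : PotentialBound V C) {A a c : ℝ} (hA : 0 ≤ A) (ha : 1 ≤ a) (hc : 0 ≤ c)

lemma S_apply (j : Fin N) (f : SchwartzMap (RN N) ℂ) :
    ⇑((system hω hV hC hA ha hc).S j f) = S2j N ω j f := sum_Dst_D_apply hω j f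

/-- The first `k` slots. -/
def firstSlots (N k : ℕ) : Finset (Fin N) := Finset.univ.filter fun j => (j : ℕ) < k

lemma firstSlots_succ {k : ℕ} (hk : k < N) :
    firstSlots N (k + 1) = insert ⟨k, hk⟩ (firstSlots N k) := by
  ext j
  simp [firstSlots, Fin.ext_iff]
  omega

lemma notMem_firstSlots {k : ℕ} (hk : k < N) : (⟨k, hk⟩ : Fin N) ∉ firstSlots N k := by
  simp [firstSlots]

lemma card_firstSlots {k : ℕ} (hk : k ≤ N) : (firstSlots N k).card = k := by
  induction k with
  | zero => simp [firstSlots]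
  | succ k ih =>
    rw [firstSlots_succ hk, Finset.card_insert_of_notMem (notMem_firstSlots hk),
      ih (by omega)]

lemma G_firstSlots_apply {k : ℕ} (hk : k ≤ N) (f : SchwartzMap (RN N) ℂ) :
    ⇑((system hω hV hC hA ha hc).G (firstSlots N k) f) = Sprod N ω k f := by
  induction k with
  | zero =>
    have : firstSlots N 0 = ∅ := by simp [firstSlots]
    rw [this, ManyBodySystem.G_empty]
    rfl
  | succ k ih =>
    rw [firstSlots_succ hk, ManyBodySystem.G_insert _ (notMem_firstSlots hk),
      Module.End.mul_apply, S_apply, ih (by omega)]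
    rfl

lemma H_apply {β : ℝ} (hA : 0 ≤ ((N : ℝ) * √ω) ^ (3 * β)) (ha : 1 ≤ ((N : ℝ) * √ω) ^ β)
    (hc : 0 ≤ 1 / ((N : ℝ) * √ω)) (f : SchwartzMap (RN N) ℂ) :
    ⇑((system hω hV hC hA ha hc).H f) = Aop N ω β V f := by
  funext p
  have h1 : ∀ (i l : Fin N), ((if i < l then (system hω hV hC hA ha hc).V i l else 0) f) p =
      if i < l then ((((N : ℝ) * √ω) ^ (3 * β) * V (((N : ℝ) * √ω) ^ β • (p i - p l)) : ℝ) : ℂ)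
        * f p else 0 := by
    intro i l
    split_ifs
    · refine (mulOp_apply (hasTemperateGrowth_const_mul_comp V.hasTemperateGrowth _ _) f p).trans ?_
      rw [separation_apply, Complex.real_smul]
    · rfl
  have h2 : ∀ j : Fin N, ((system hω hV hC hA ha hc).S j f) p = ((1 - ω : ℝ) : ℂ) * f p +
      (-lapj N j f p + ((ω ^ 2 * (p j).2 ^ 2 : ℝ) : ℂ) * f p) := by
    intro j
    rw [S_apply]
    simp [S2j, coordZ]
    ring
  simp only [ManyBodySystem.H, LinearMap.add_apply, LinearMap.sum_apply, LinearMap.smul_apply,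
    _root_.add_apply, _root_.sum_apply, _root_.smul_apply, h1, h2]
  rw [Finset.sum_add_distrib, Finset.sum_const, Finset.card_univ, Fintype.card_fin, nsmul_eq_mul]
  change _ + (1 / ((N : ℝ) * √ω)) • _ = _
  rw [Complex.real_smul, Aop, Hop]
  push_cast
  ring

lemma H_pow_apply {β : ℝ} (hA : 0 ≤ ((N : ℝ) * √ω) ^ (3 * β)) (ha : 1 ≤ ((N : ℝ) * √ω) ^ β)
    (hc : 0 ≤ 1 / ((N : ℝ) * √ω)) (k : ℕ) (f : SchwartzMap (RN N) ℂ) :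
    ⇑(((system hω hV hC hA ha hc).H ^ k) f) = Apow N ω β V k f := by
  induction k with
  | zero => rfl
  | succ k ih =>
    rw [pow_succ', Module.End.mul_apply, H_apply, ih]
    rfl

end System

lemma re_ipN (f g : SchwartzMap (RN N) ℂ) : (ipN N f g).re = l2form volume f g := by
  by_cases hi : Integrable (fun p => (starRingEnd ℂ) (f p) * g p) (volume : Measure (RN N))
  · rw [ipN, l2form_apply]
    refine (reCLM.integral_comp_comm hi).symm.trans (integral_congr_ae (.of_forall fun p => ?_))
    simp [Complex.inner, mul_comm]
  · refine absurd ?_ hi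
    have hf : Integrable (fun p => g p) (volume : Measure (RN N)) := g.integrable
    obtain ⟨K, -, hK⟩ := f.decay 0 0
    refine hf.bdd_mul (c := K) ?_ (.of_forall fun p => ?_)
    · exact (Complex.continuous_conj.comp f.continuous).aestronglyMeasurable
    · simpa using hK p

/-! ### Permutation symmetry -/

/-- Permutation of the particles. -/
def permEquiv (σ : Equiv.Perm (Fin N)) : RN N ≃L[ℝ] RN N :=
  ContinuousLinearEquiv.piCongrLeft ℝ (fun _ => R3) σ.symm

lemma permEquiv_apply (σ : Equiv.Perm (Fin N)) (p : RN N) :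
    permEquiv σ p = fun i => p (σ i) := by
  funext i
  exact eq_rec_constant _ _

/-- The action of a permutation of the particles on Schwartz functions. -/
def permOp (σ : Equiv.Perm (Fin N)) : Module.End ℝ (SchwartzMap (RN N) ℂ) :=
  (compCLMOfContinuousLinearEquiv ℝ (permEquiv σ)).toLinearMap

lemma permOp_apply (σ : Equiv.Perm (Fin N)) (f : SchwartzMap (RN N) ℂ) (p : RN N) :
    permOp σ f p = f (permEquiv σ p) := rfl

lemma l2form_permOp (σ : Equiv.Perm (Fin N)) (f g : SchwartzMap (RN N) ℂ) :
    l2form volume (permOp σ f) (permOp σ g) = l2form volume f g :=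
  (volume_measurePreserving_piCongrLeft (fun _ : Fin N => R3) σ.symm).integral_comp'
    (fun p => inner ℝ (f p) (g p))

lemma derivOp_permOp (σ : Equiv.Perm (Fin N)) (j : Fin N) (v : R3) :
    derivOp (dirN N (σ j) v) * permOp σ = permOp σ * derivOp (dirN N j v) := by
  refine LinearMap.ext fun f => ?_
  have h : permEquiv σ (dirN N (σ j) v) = dirN N j v := by
    rw [permEquiv_apply]
    funext i
    simp [dirN_apply]
  have := lineDerivOp_compCLMOfContinuousLinearEquiv ℝ (dirN N (σ j) v) (permEquiv σ) f
  rwa [h] at this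

lemma mulOp_permOp {ω : ℝ} (hω : 0 ≤ ω) (σ : Equiv.Perm (Fin N)) (j : Fin N) (m : Fin 4) :
    mulOp (slotFn ω (σ j) m) * permOp σ = permOp σ * mulOp (slotFn ω j m) := by
  refine LinearMap.ext fun f => SchwartzMap.ext fun p => ?_
  have h : slotFn ω j m (permEquiv σ p) = slotFn ω (σ j) m p := by
    rw [permEquiv_apply]
    fin_cases m <;> simp [slotFn, height]
  have h1 := mulOp_apply ((slot hω (σ j)).temperate m) (permOp σ f) p
  have h2 := mulOp_apply ((slot hω j).temperate m) f (permEquiv σ p)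
  exact h1.trans ((congrArg (· • f (permEquiv σ p)) h.symm).trans h2.symm)

lemma sum_Dst_D_permOp {ω : ℝ} (hω : 0 ≤ ω) (σ : Equiv.Perm (Fin N)) (j : Fin N) :
    (∑ m, (slot hω (σ j)).Dst m * (slot hω (σ j)).D m) * permOp σ =
      permOp σ * ∑ m, (slot hω j).Dst m * (slot hω j).D m := by
  rw [Finset.sum_mul, Finset.mul_sum]
  refine Finset.sum_congr rfl fun m _ => ?_
  have h1 : (slot hω (σ j)).D m * permOp σ = permOp σ * (slot hω j).D m := by
    rw [Slot.D, Slot.D, add_mul, mul_add]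
    exact congrArg₂ _ (derivOp_permOp σ j (e m)) (mulOp_permOp hω σ j m)
  have h2 : (slot hω (σ j)).Dst m * permOp σ = permOp σ * (slot hω j).Dst m := by
    rw [Slot.Dst, Slot.Dst, add_mul, mul_add, neg_mul, mul_neg]
    exact congrArg₂ (fun x y => -x + y) (derivOp_permOp σ j (e m)) (mulOp_permOp hω σ j m)
  rw [mul_assoc, h1, ← mul_assoc, h2, mul_assoc]

section System

variable {ω : ℝ} (hω : 0 ≤ ω) {V : SchwartzMap R3 ℝ} (hV : ∀ r, 0 ≤ V r) {C : ℝ}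
  (hC : PotentialBound V C) {A a c : ℝ} (hA : 0 ≤ A) (ha : 1 ≤ a) (hc : 0 ≤ c)

lemma G_permOp (σ : Equiv.Perm (Fin N)) (J : Finset (Fin N)) :
    (system hω hV hC hA ha hc).G (J.map σ.toEmbedding) * permOp σ =
      permOp σ * (system hω hV hC hA ha hc).G J := by
  induction J using Finset.induction_on with
  | empty => rw [Finset.map_empty, ManyBodySystem.G_empty, one_mul, mul_one]
  | insert j J hj ih =>
    have hj' : σ j ∉ J.map σ.toEmbedding := by simpa using hj
    have hS : (system hω hV hC hA ha hc).S (σ j) * permOp σ =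
      permOp σ * (system hω hV hC hA ha hc).S j := sum_Dst_D_permOp hω σ j
    rw [Finset.map_insert, Equiv.toEmbedding_apply, ManyBodySystem.G_insert _ hj',
      ManyBodySystem.G_insert _ hj, mul_assoc, ih, ← mul_assoc, hS, mul_assoc]

lemma g_eq_of_card_eq {ψ : SchwartzMap (RN N) ℂ}
    (hψ : ∀ σ : Equiv.Perm (Fin N), ∀ p : RN N, ψ (fun i => p (σ i)) = ψ p)
    {J K : Finset (Fin N)} (h : J.card = K.card) :
    (system hω hV hC hA ha hc).g ψ J = (system hω hV hC hA ha hc).g ψ K := by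
  obtain ⟨σ, rfl⟩ := Equiv.Perm.exists_map_finset_eq J K h
  have hσ : permOp σ ψ = ψ := SchwartzMap.ext fun p => by
    rw [permOp_apply, permEquiv_apply, hψ]
  have h1 := LinearMap.congr_fun (G_permOp hω hV hC hA ha hc σ J) ψ
  rw [Module.End.mul_apply, Module.End.mul_apply, hσ] at h1
  have h2 := l2form_permOp σ ψ ((system hω hV hC hA ha hc).G J ψ)
  rw [hσ, ← h1] at h2
  exact h2.symm

end System

/-- The smallness conditions on the coupling hold for large particle number. -/
lemma eventually_small {ω β C : ℝ} (hω : 1 ≤ ω) (hβ0 : 0 < β) (hβ1 : β < 2 / 5) (k : ℕ) :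
    ∀ᶠ N : ℕ in Filter.atTop,
      4 * (1 / ((N : ℝ) * √ω)) * (5 / 2 * (4 * (1 + ω)) *
        (((N : ℝ) * √ω) ^ (3 * β) * C / ((N : ℝ) * √ω) ^ β)) * (k + 1) ≤ 3 / 8 ∧
      2 * (1 / ((N : ℝ) * √ω)) * (48 * (((N : ℝ) * √ω) ^ (3 * β) *
        (((N : ℝ) * √ω) ^ β) ^ 2 * C)) * (k + 1) ^ 2 ≤ 3 / 8 * (N - (k + 1)) := by
  have hsω : 0 < √ω := Real.sqrt_pos.2 (by linarith)
  have hM : Filter.Tendsto (fun N : ℕ => (N : ℝ) * √ω) Filter.atTop Filter.atTop :=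
    tendsto_natCast_atTop_atTop.atTop_mul_const hsω
  have hz : ∀ (γ K : ℝ), 0 < γ →
      Filter.Tendsto (fun N : ℕ => K * ((N : ℝ) * √ω) ^ (-γ)) Filter.atTop (nhds 0) :=
    fun γ K hγ => by
      simpa using ((tendsto_rpow_neg_atTop hγ).comp hM).const_mul K
  have h1 := (hz (1 - 2 * β) (4 * (5 / 2 * (4 * (1 + ω)) * C) * (k + 1))
    (by linarith)).eventually_le_const (by norm_num : (0 : ℝ) < 3 / 8)
  have h2 := (hz (2 - 5 * β) (2 * (48 * C) * (k + 1) ^ 2 * √ω)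
    (by linarith)).eventually_le_const (by norm_num : (0 : ℝ) < 3 / 16)
  filter_upwards [h1, h2, Filter.eventually_ge_atTop (2 * (k + 1))] with N h1 h2 hN
  have hN' : 2 * ((k : ℝ) + 1) ≤ N := by exact_mod_cast hN
  have hN0 : (0 : ℝ) < N := by
    have : (0 : ℝ) ≤ k := k.cast_nonneg
    linarith
  have hpos : 0 < (N : ℝ) * √ω := by positivity
  have e1 : ((N : ℝ) * √ω) ^ (-(1 - 2 * β)) = ((N : ℝ) * √ω) ^ (3 * β) /
      ((N : ℝ) * √ω) ^ β / ((N : ℝ) * √ω) := by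
    rw [← Real.rpow_sub hpos, ← Real.rpow_sub_one hpos.ne']
    ring_nf
  have e2 : ((N : ℝ) * √ω) ^ (-(2 - 5 * β)) = ((N : ℝ) * √ω) ^ (3 * β) *
      (((N : ℝ) * √ω) ^ β) ^ 2 / ((N : ℝ) * √ω) / ((N : ℝ) * √ω) := by
    rw [← Real.rpow_mul_natCast hpos.le, ← Real.rpow_add hpos, ← Real.rpow_sub_one hpos.ne',
      ← Real.rpow_sub_one hpos.ne']
    push_cast
    ring_nf
  rw [e1] at h1
  rw [e2] at h2
  constructor
  · refine le_of_eq_of_le ?_ h1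
    ring
  · have h3 := mul_le_mul_of_nonneg_right h2 hN0.le
    refine le_trans (le_of_eq_of_le ?_ h3) (by linarith)
    field_simp

end Concrete

/-- energy estimate: for a nonnegative Schwartz interaction `V`,
`0 < β < 2/5` and `ε > 0`, there is `C > 0` so that for every `k` and `ω ≥ 1` there
is `N₀(k, ω)` such that for all `N ≥ N₀` with `N ≥ ω^{v(β)+ε}` and all
permutation-symmetric Schwartz `ψ` on ℝ^{3N},
`⟨ψ, (N + H_{N,ω} − Nω)^k ψ⟩ ≥ C^k N^k ⟨ψ, ∏_{j=1}^k S_j² ψ⟩`. -/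
theorem energy_estimate (V : SchwartzMap R3 ℝ) (hV : ∀ r : R3, 0 ≤ V r)
    (β : ℝ) (hβ0 : 0 < β) (hβ1 : β < 2 / 5) (ε : ℝ) (hε : 0 < ε) :
    ∃ C : ℝ, 0 < C ∧ ∀ k : ℕ, ∀ ω : ℝ, 1 ≤ ω → ∃ N₀ : ℕ, ∀ N : ℕ, N₀ ≤ N →
      ω ^ (vbeta β + ε) ≤ (N : ℝ) →
      ∀ ψ : SchwartzMap (RN N) ℂ,
        (∀ σ : Equiv.Perm (Fin N), ∀ p : RN N, ψ (fun i => p (σ i)) = ψ p) →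
        C ^ k * (N : ℝ) ^ k * (ipN N (⇑ψ) (Sprod N ω k (⇑ψ))).re ≤
          (ipN N (⇑ψ) (Apow N ω β (fun r => V r) k (⇑ψ))).re := by
  obtain ⟨C, hC⟩ := Concrete.exists_potentialBound V
  refine ⟨1 / 4, by norm_num, fun k ω hω => ?_⟩
  obtain ⟨N₀, hN₀⟩ := Filter.eventually_atTop.1
    ((Concrete.eventually_small (C := C) hω hβ0 hβ1 k).and
      (Filter.eventually_ge_atTop (2 * k + 2)))
  refine ⟨N₀, fun N hN _ ψ hψ => ?_⟩
  obtain ⟨⟨h₁, h₂⟩, hk⟩ := hN₀ N hN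
  have hω0 : 0 ≤ ω := by linarith
  have hM : 1 ≤ (N : ℝ) * √ω := one_le_mul_of_one_le_of_one_le
    (by exact_mod_cast (by omega : 1 ≤ N)) (Real.one_le_sqrt.2 hω)
  have hA : 0 ≤ ((N : ℝ) * √ω) ^ (3 * β) := Real.rpow_nonneg (by linarith) _
  have ha : 1 ≤ ((N : ℝ) * √ω) ^ β := Real.one_le_rpow hM hβ0.le
  have hc : 0 ≤ 1 / ((N : ℝ) * √ω) := by positivity
  have key := (Concrete.system hω0 hV hC hA ha hc).energy_estimate_of_card (f := ψ)
    (t := fun n => (Concrete.system hω0 hV hC hA ha hc).g ψ (Concrete.firstSlots N n))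
    (fun J => Concrete.g_eq_of_card_eq hω0 hV hC hA ha hc hψ
      (Concrete.card_firstSlots (by simpa using J.card_le_univ)).symm) k hk h₁ h₂
  rw [← Concrete.G_firstSlots_apply hω0 hV hC hA ha hc (by omega) ψ,
    ← Concrete.H_pow_apply hω0 hV hC hA ha hc k ψ, Concrete.re_ipN, Concrete.re_ipN]
  exact key
end
end

section
/- There is a constant C > 0 such that for every ω ≥ 1, every real-valued Schwartz function W on ℝ³, and every Schwartz function f on ℝ³ × ℝ³ (variables r₁ = (x₁,z₁), r₂ = (x₂,z₂)), one has ω · |∫∫ W(r₁−r₂) |f(r₁,r₂)|² dr₁ dr₂| ≤ C ω^{4/3} ‖W‖_{L^{3/2}(ℝ³)} ⟨f, S₂²f⟩_{L²(ℝ⁶)}. -/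
open MeasureTheory Complex

noncomputable section

/-- ℝ³ × ℝ³, points (r₁, r₂). -/
abbrev R6 : Type := R3 × R3

/-- The Laplacian in the r₁-variable on ℝ³ × ℝ³. -/
def lapFst (f : R6 → ℂ) (p : R6) : ℂ :=
  pd2 (ex0, (0 : R3)) f p + pd2 (ex1, (0 : R3)) f p + pd2 (ez, (0 : R3)) f p

/-- The Laplacian in the r₂-variable on ℝ³ × ℝ³. -/
def lapSnd (f : R6 → ℂ) (p : R6) : ℂ :=
  pd2 ((0 : R3), ex0) f p + pd2 ((0 : R3), ex1) f p + pd2 ((0 : R3), ez) f p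

/-- `S₁² f = (1−ω)f − Δ_{r₁}f + ω² z₁² f`. -/
def S1sq (ω : ℝ) (f : R6 → ℂ) (p : R6) : ℂ :=
  ((1 - ω : ℝ) : ℂ) * f p - lapFst f p + ((ω ^ 2 * p.1.2 ^ 2 : ℝ) : ℂ) * f p

/-- `S₂² f = (1−ω)f − Δ_{r₂}f + ω² z₂² f`. -/
def S2sq (ω : ℝ) (f : R6 → ℂ) (p : R6) : ℂ :=
  ((1 - ω : ℝ) : ℂ) * f p - lapSnd f p + ((ω ^ 2 * p.2.2 ^ 2 : ℝ) : ℂ) * f p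

/-- The L²(ℝ⁶) inner product `⟨f, g⟩ = ∫ conj(f) g`. -/
def ip6 (f g : R6 → ℂ) : ℂ := ∫ p : R6, (starRingEnd ℂ) (f p) * g p

section Sobolev

open Filter Topology
open scoped ENNReal NNReal

variable {E F : Type*} [NormedAddCommGroup E] [NormedSpace ℝ E] [FiniteDimensional ℝ E]
  [MeasurableSpace E] [BorelSpace E] [NormedAddCommGroup F] [NormedSpace ℝ F]

/-- Smooth compactly supported functions `u` approximating `g` pointwise whose derivatives exceed
`fderiv ℝ g` in `Lᵖ` by at most a vanishing multiple of the `Lᵖ` norm of `g`. -/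
theorem exists_cutoff_seq (μ : Measure E) {g : E → F} (hg : ContDiff ℝ 1 g) {p : ℝ≥0∞}
    (hp : 1 ≤ p) :
    ∃ (u : ℕ → E → F) (M : ℝ), (∀ n, ContDiff ℝ 1 (u n)) ∧ (∀ n, HasCompactSupport (u n)) ∧
      (∀ x, Tendsto (fun n ↦ u n x) atTop (𝓝 (g x))) ∧
      ∀ n, eLpNorm (fderiv ℝ (u n)) p μ ≤
        eLpNorm (fderiv ℝ g) p μ + ENNReal.ofReal (M * (1 / ((n : ℝ) + 1))) * eLpNorm g p μ := by
  let χ : ContDiffBump (0 : E) := ⟨1, 2, one_pos, one_lt_two⟩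
  have hχ : ContDiff ℝ 1 χ := χ.contDiff
  obtain ⟨M, hM⟩ := (hχ.continuous_fderiv one_ne_zero).bounded_above_of_compact_support
    (χ.hasCompactSupport.fderiv ℝ)
  let a : ℕ → ℝ := fun n ↦ 1 / ((n : ℝ) + 1)
  have ha (n : ℕ) : 0 < a n := Nat.one_div_pos_of_nat
  have ha0 : Tendsto a atTop (𝓝 0) := tendsto_one_div_add_atTop_nhds_zero_nat
  have hc (n : ℕ) : ContDiff ℝ 1 (fun x ↦ χ (a n • x)) := hχ.comp (by fun_prop)
  refine ⟨fun n x ↦ χ (a n • x) • g x, M, fun n ↦ (hc n).smul hg, fun n ↦ ?_, fun x ↦ ?_,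
    fun n ↦ ?_⟩
  · have : HasCompactSupport (fun x ↦ χ (a n • x)) :=
      χ.hasCompactSupport.comp_homeomorph (Homeomorph.smulOfNeZero (a n) (ha n).ne')
    exact this.smul_right
  · have h1 : Tendsto (fun n ↦ χ (a n • x)) atTop (𝓝 (χ ((0 : ℝ) • x))) :=
      (hχ.continuous.tendsto _).comp (ha0.smul_const x)
    have h2 : χ ((0 : ℝ) • x) = 1 := by
      rw [zero_smul]
      exact χ.one_of_mem_closedBall (by simpa using χ.rIn_pos.le)
    have := h1.smul_const (g x)
    rwa [h2, one_smul] at this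
  · have hpt (x : E) : ‖fderiv ℝ (fun x ↦ χ (a n • x) • g x) x‖ ≤
        ‖fderiv ℝ g x‖ + (M * a n) * ‖g x‖ := by
      rw [fderiv_fun_smul ((hc n).differentiable one_ne_zero x) (hg.differentiable one_ne_zero x),
        fderiv_comp_smul]
      refine (norm_add_le _ _).trans (add_le_add ?_ ?_)
      · rw [norm_smul, Real.norm_of_nonneg χ.nonneg]
        exact mul_le_of_le_one_left (norm_nonneg _) χ.le_one
      · rw [ContinuousLinearMap.norm_smulRight_apply, norm_smul, Real.norm_of_nonneg (ha n).le]
        rw [mul_comm M]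
        exact mul_le_mul_of_nonneg_right (mul_le_mul_of_nonneg_left (hM _) (ha n).le)
          (norm_nonneg _)
    calc eLpNorm (fderiv ℝ (fun x ↦ χ (a n • x) • g x)) p μ
        ≤ eLpNorm (fun x ↦ ‖fderiv ℝ g x‖ + (M * a n) * ‖g x‖) p μ := eLpNorm_mono_real hpt
      _ ≤ eLpNorm (fun x ↦ ‖fderiv ℝ g x‖) p μ + eLpNorm (fun x ↦ (M * a n) * ‖g x‖) p μ := by
        refine eLpNorm_add_le ?_ ?_ hp
        · exact (hg.continuous_fderiv one_ne_zero).norm.aestronglyMeasurable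
        · exact (continuous_const.mul hg.continuous.norm).aestronglyMeasurable
      _ = _ := by
        have hMn : 0 ≤ M * a n := mul_nonneg ((norm_nonneg _).trans (hM 0)) (ha n).le
        have := eLpNorm_const_smul (M * a n) (fun x ↦ ‖g x‖) p μ
        simp only [Pi.smul_def, smul_eq_mul] at this
        rw [eLpNorm_norm, this, eLpNorm_norm, Real.enorm_eq_ofReal hMn]

/-- The **Gagliardo-Nirenberg-Sobolev inequality** for continuously differentiable functions in
`Lᵖ`, with no assumption on the support. -/
theorem eLpNorm_le_eLpNorm_fderiv_of_eLpNorm_ne_top [FiniteDimensional ℝ F] (μ : Measure E)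
    [μ.IsAddHaarMeasure] {g : E → F} (hg : ContDiff ℝ 1 g) {p p' : ℝ≥0} (hp : 1 ≤ p)
    (hn : 0 < Module.finrank ℝ E) (hp' : (p' : ℝ)⁻¹ = (p : ℝ)⁻¹ - (Module.finrank ℝ E : ℝ)⁻¹)
    (hgp : eLpNorm g p μ ≠ ∞) :
    eLpNorm g p' μ ≤ SNormLESNormFDerivOfEqConst F μ p * eLpNorm (fderiv ℝ g) p μ := by
  obtain ⟨u, M, hu, hus, hlim, hbd⟩ := exists_cutoff_seq μ hg (p := p) (by exact_mod_cast hp)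
  set K : ℝ≥0∞ := (SNormLESNormFDerivOfEqConst F μ p : ℝ≥0∞)
  have hfatou : eLpNorm g p' μ ≤ liminf (fun n ↦ eLpNorm (u n) p' μ) atTop :=
    Lp.eLpNorm_lim_le_liminf_eLpNorm (fun n ↦ (hu n).continuous.aestronglyMeasurable) g
      (ae_of_all _ hlim)
  have htend : Tendsto (fun n : ℕ ↦ K * (eLpNorm (fderiv ℝ g) p μ +
      ENNReal.ofReal (M * (1 / ((n : ℝ) + 1))) * eLpNorm g p μ)) atTop
      (𝓝 (K * (eLpNorm (fderiv ℝ g) p μ + 0 * eLpNorm g p μ))) := by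
    refine ENNReal.Tendsto.const_mul (tendsto_const_nhds.add ?_) (Or.inr ENNReal.coe_ne_top)
    refine ENNReal.Tendsto.mul_const ?_ (Or.inr hgp)
    simpa using ENNReal.tendsto_ofReal
      ((tendsto_one_div_add_atTop_nhds_zero_nat (𝕜 := ℝ)).const_mul M)
  calc eLpNorm g p' μ ≤ liminf (fun n ↦ eLpNorm (u n) p' μ) atTop := hfatou
    _ ≤ liminf (fun n : ℕ ↦ K * (eLpNorm (fderiv ℝ g) p μ +
        ENNReal.ofReal (M * (1 / ((n : ℝ) + 1))) * eLpNorm g p μ)) atTop := by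
      refine liminf_le_liminf (.of_forall fun n ↦ ?_)
      refine (eLpNorm_le_eLpNorm_fderiv_of_eq μ (hu n) (hus n) hp hn hp').trans ?_
      gcongr
      exact hbd n
    _ = K * eLpNorm (fderiv ℝ g) p μ := by rw [htend.liminf_eq, zero_mul, add_zero]

end Sobolev

section Anisotropic

open scoped ENNReal NNReal

instance : (volume : Measure R3).IsAddHaarMeasure :=
  Measure.prod.instIsAddHaarMeasure (volume : Measure R2) (volume : Measure ℝ)

instance : (volume : Measure R6).IsAddHaarMeasure :=
  Measure.prod.instIsAddHaarMeasure (volume : Measure R3) (volume : Measure R3)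

/-- The dilation `(x, z) ↦ (x, s z)` of ℝ³. -/
def dilateZ (s : ℝ) : R3 →L[ℝ] R3 :=
  (ContinuousLinearMap.id ℝ R2).prodMap (s • ContinuousLinearMap.id ℝ ℝ)

@[simp]
theorem dilateZ_apply (s : ℝ) (p : R3) : dilateZ s p = (p.1, s * p.2) := rfl

theorem lintegral_comp_dilateZ {s : ℝ} (hs : 0 < s) {h : R3 → ℝ≥0∞} (hh : Measurable h) :
    ∫⁻ p, h (dilateZ s p) = ENNReal.ofReal s⁻¹ * ∫⁻ p, h p := by
  have hd : Measurable fun p ↦ h (dilateZ s p) := hh.comp (dilateZ s).continuous.measurable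
  rw [Measure.volume_eq_prod, lintegral_prod _ hd.aemeasurable, lintegral_prod _ hh.aemeasurable,
    ← lintegral_const_mul _ hh.lintegral_prod_right']
  refine lintegral_congr fun x ↦ ?_
  have hx : Measurable fun z : ℝ ↦ h (x, z) := hh.comp measurable_prodMk_left
  calc ∫⁻ z, h (x, s * z) = ∫⁻ z, h (x, z) ∂(Measure.map (fun z ↦ s * z) volume) :=
        (lintegral_map hx (measurable_const_mul s)).symm
    _ = ENNReal.ofReal s⁻¹ * ∫⁻ z, h (x, z) := by
        rw [Real.map_volume_mul_left hs.ne', lintegral_smul_measure, smul_eq_mul,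
          abs_of_pos (inv_pos.2 hs)]

theorem norm_le_sum_norm_apply_basis (T : R3 →L[ℝ] ℂ) :
    ‖T‖ ≤ ‖T ex0‖ + ‖T ex1‖ + ‖T ez‖ := by
  refine T.opNorm_le_bound (by positivity) fun v ↦ ?_
  have hv : v = v.1 0 • ex0 + v.1 1 • ex1 + v.2 • ez := by
    refine Prod.ext ?_ (by simp [ex0, ex1, ez])
    ext i
    fin_cases i <;> simp [ex0, ex1, ez]
  have h0 : ‖v.1 0‖ ≤ ‖v‖ := (PiLp.norm_apply_le v.1 0).trans (norm_fst_le v)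
  have h1 : ‖v.1 1‖ ≤ ‖v‖ := (PiLp.norm_apply_le v.1 1).trans (norm_fst_le v)
  have h2 : ‖v.2‖ ≤ ‖v‖ := norm_snd_le v
  calc ‖T v‖ = ‖v.1 0 • T ex0 + v.1 1 • T ex1 + v.2 • T ez‖ := by
        conv_lhs => rw [hv]
        simp only [map_add, map_smul]
    _ ≤ ‖v.1 0‖ * ‖T ex0‖ + ‖v.1 1‖ * ‖T ex1‖ + ‖v.2‖ * ‖T ez‖ := by
        simp only [← norm_smul]
        exact norm_add₃_le
    _ ≤ ‖v‖ * ‖T ex0‖ + ‖v‖ * ‖T ex1‖ + ‖v‖ * ‖T ez‖ := by gcongr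
    _ = _ := by ring

/-- The squared gradient of `g` with its `z`-component weighted by `s²`. -/
def wgradSq (s : ℝ) (g : R3 → ℂ) (p : R3) : ℝ :=
  ‖pd ex0 g p‖ ^ 2 + ‖pd ex1 g p‖ ^ 2 + s ^ 2 * ‖pd ez g p‖ ^ 2

theorem norm_fderiv_comp_dilateZ_sq_le {g : R3 → ℂ} (hg : Differentiable ℝ g) (s : ℝ) (p : R3) :
    ‖fderiv ℝ (fun q ↦ g (dilateZ s q)) p‖ ^ 2 ≤ 3 * wgradSq s g (dilateZ s p) := by
  have hfd : fderiv ℝ (fun q ↦ g (dilateZ s q)) p =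
      (fderiv ℝ g (dilateZ s p)).comp (dilateZ s) := by
    rw [fderiv_fun_comp p (hg _) (dilateZ s).differentiableAt, ContinuousLinearMap.fderiv]
  have e0 : dilateZ s ex0 = ex0 := by simp [ex0]
  have e1 : dilateZ s ex1 = ex1 := by simp [ex1]
  have e2 : dilateZ s ez = s • ez := by simp [ez]
  have hT := norm_le_sum_norm_apply_basis (fderiv ℝ (fun q ↦ g (dilateZ s q)) p)
  simp only [hfd, ContinuousLinearMap.comp_apply, e0, e1, e2, map_smul, norm_smul] at hT ⊢
  refine (pow_le_pow_left₀ (norm_nonneg _) hT 2).trans ?_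
  rw [wgradSq, ← sq_abs s, ← Real.norm_eq_abs]
  simp only [pd]
  generalize ‖fderiv ℝ g (dilateZ s p) ex0‖ = a
  generalize ‖fderiv ℝ g (dilateZ s p) ex1‖ = b
  generalize ‖fderiv ℝ g (dilateZ s p) ez‖ = c
  nlinarith [sq_nonneg (a - b), sq_nonneg (b - ‖s‖ * c), sq_nonneg (a - ‖s‖ * c)]

theorem continuous_pd {E F : Type*} [NormedAddCommGroup E] [NormedSpace ℝ E]
    [NormedAddCommGroup F] [NormedSpace ℝ F] {g : E → F} (hg : ContDiff ℝ 1 g) (v : E) :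
    Continuous (pd v g) :=
  (hg.continuous_fderiv one_ne_zero).clm_apply continuous_const

theorem continuous_wgradSq {g : R3 → ℂ} (hg : ContDiff ℝ 1 g) (s : ℝ) :
    Continuous (wgradSq s g) := by
  have h (v : R3) := continuous_pd hg v
  unfold wgradSq
  fun_prop

theorem wgradSq_nonneg (s : ℝ) (g : R3 → ℂ) (p : R3) : 0 ≤ wgradSq s g p := by
  unfold wgradSq
  positivity

/-- Anisotropic Sobolev inequality on ℝ³. -/
theorem exists_lintegral_pow_three_le_wgradSq :
    ∃ K : ℝ≥0, ∀ (s : ℝ), 0 < s → ∀ g : R3 → ℂ, ContDiff ℝ 1 g → MemLp g 2 volume →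
      (∫⁻ p, (‖g p‖ₑ ^ 2) ^ (3 : ℝ)) ^ (1 / 3 : ℝ) ≤
        K * ENNReal.ofReal (s ^ (-(2 / 3) : ℝ)) * ∫⁻ p, ENNReal.ofReal (wgradSq s g p) := by
  set K₀ : ℝ≥0 := SNormLESNormFDerivOfEqConst ℂ (volume : Measure R3) (2 : ℝ≥0)
  refine ⟨K₀ ^ 2 * 3, fun s hs g hg hg2 ↦ ?_⟩
  set G : R3 → ℂ := fun q ↦ g (dilateZ s q)
  have hG : ContDiff ℝ 1 G := hg.comp (dilateZ s).contDiff
  have hmeas : Measurable g := hg.continuous.measurable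
  have hG2 : eLpNorm G (2 : ℝ≥0) volume ≠ ∞ := by
    have h2 : ∫⁻ p, ‖g p‖ₑ ^ (2 : ℝ) ≠ ∞ := by
      have := hg2.eLpNorm_ne_top
      rw [eLpNorm_eq_lintegral_rpow_enorm_toReal two_ne_zero ENNReal.ofNat_ne_top] at this
      intro h
      simp [-ENNReal.rpow_ofNat, h] at this
    rw [eLpNorm_nnreal_eq_lintegral two_ne_zero]
    refine ENNReal.rpow_ne_top_of_nonneg (by positivity) ?_
    have := lintegral_comp_dilateZ hs (h := fun p ↦ ‖g p‖ₑ ^ (2 : ℝ)) (by fun_prop)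
    simp only [NNReal.coe_ofNat, G, this]
    exact ENNReal.mul_ne_top ENNReal.ofReal_ne_top h2
  have hsob : eLpNorm G (6 : ℝ≥0) volume ≤ K₀ * eLpNorm (fderiv ℝ G) (2 : ℝ≥0) volume :=
    eLpNorm_le_eLpNorm_fderiv_of_eLpNorm_ne_top volume hG one_le_two (by simp)
      (by simp; norm_num) hG2
  have hsq : (∫⁻ p, ‖G p‖ₑ ^ (6 : ℝ)) ^ (1 / 3 : ℝ) ≤
      K₀ ^ 2 * ∫⁻ p, ‖fderiv ℝ G p‖ₑ ^ 2 := by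
    have := pow_le_pow_left₀ zero_le hsob 2
    rw [eLpNorm_nnreal_eq_lintegral (by norm_num), eLpNorm_nnreal_eq_lintegral two_ne_zero,
      mul_pow, ← ENNReal.rpow_natCast _ 2, ← ENNReal.rpow_natCast (_ ^ (_ : ℝ)) 2,
      ← ENNReal.rpow_mul, ← ENNReal.rpow_mul] at this
    norm_num at this
    simpa using this
  have hgrad : ∫⁻ p, ‖fderiv ℝ G p‖ₑ ^ 2 ≤
      3 * (ENNReal.ofReal s⁻¹ * ∫⁻ p, ENNReal.ofReal (wgradSq s g p)) := by
    have hw : Measurable fun p ↦ ENNReal.ofReal (wgradSq s g p) :=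
      (continuous_wgradSq hg s).measurable.ennreal_ofReal
    rw [← lintegral_comp_dilateZ hs hw,
      ← lintegral_const_mul (f := fun p ↦ ENNReal.ofReal (wgradSq s g (dilateZ s p))) _
        (hw.comp (dilateZ s).continuous.measurable)]
    refine lintegral_mono fun p ↦ ?_
    have := ENNReal.ofReal_le_ofReal
      (norm_fderiv_comp_dilateZ_sq_le (hg.differentiable one_ne_zero) s p)
    rwa [ENNReal.ofReal_pow (norm_nonneg _), ofReal_norm,
      ENNReal.ofReal_mul (by norm_num), ENNReal.ofReal_ofNat] at this
  have hleft : (∫⁻ p, ‖G p‖ₑ ^ (6 : ℝ)) ^ (1 / 3 : ℝ) =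
      ENNReal.ofReal (s ^ (-(1 / 3) : ℝ)) *
        (∫⁻ p, (‖g p‖ₑ ^ 2) ^ (3 : ℝ)) ^ (1 / 3 : ℝ) := by
    have h6 (x : ℝ≥0∞) : (x ^ 2) ^ (3 : ℝ) = x ^ (6 : ℝ) := by
      rw [← ENNReal.rpow_natCast, ← ENNReal.rpow_mul]
      norm_num
    simp only [h6, G]
    rw [lintegral_comp_dilateZ hs (h := fun p ↦ ‖g p‖ₑ ^ (6 : ℝ)) (by fun_prop),
      ENNReal.mul_rpow_of_nonneg _ _ (by norm_num),
      ENNReal.ofReal_rpow_of_pos (inv_pos.2 hs), Real.inv_rpow hs.le, Real.rpow_neg hs.le]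
  have hcancel : ENNReal.ofReal (s ^ (1 / 3 : ℝ)) * ENNReal.ofReal (s ^ (-(1 / 3) : ℝ)) = 1 := by
    rw [← ENNReal.ofReal_mul (by positivity), ← Real.rpow_add hs]
    simp
  have hexp : ENNReal.ofReal (s ^ (1 / 3 : ℝ)) * ENNReal.ofReal s⁻¹ =
      ENNReal.ofReal (s ^ (-(2 / 3) : ℝ)) := by
    rw [← ENNReal.ofReal_mul (by positivity), ← Real.rpow_neg_one, ← Real.rpow_add hs]
    norm_num
  calc (∫⁻ p, (‖g p‖ₑ ^ 2) ^ (3 : ℝ)) ^ (1 / 3 : ℝ)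
      = ENNReal.ofReal (s ^ (1 / 3 : ℝ)) * (∫⁻ p, ‖G p‖ₑ ^ (6 : ℝ)) ^ (1 / 3 : ℝ) := by
        rw [hleft, ← mul_assoc, hcancel, one_mul]
    _ ≤ ENNReal.ofReal (s ^ (1 / 3 : ℝ)) * (K₀ ^ 2 *
          (3 * (ENNReal.ofReal s⁻¹ * ∫⁻ p, ENNReal.ofReal (wgradSq s g p)))) := by
        gcongr
        exact hsq.trans (by gcongr)
    _ = _ := by
        rw [← hexp]
        push_cast
        ring

end Anisotropic

section Energy

open scoped LineDeriv SchwartzMap InnerProductSpace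

variable {D : Type*} [NormedAddCommGroup D] [NormedSpace ℝ D]

theorem pd_schwartz (u : 𝓢(D, ℂ)) (m : D) : pd m u = (∂_{m} u : 𝓢(D, ℂ)) :=
  funext fun x ↦ (SchwartzMap.lineDerivOp_apply_eq_fderiv m u x).symm

theorem lineDerivOp_smulLeftCLM (ℓ : D →L[ℝ] ℝ) (u : 𝓢(D, ℂ)) (m x : D) :
    (∂_{m} (SchwartzMap.smulLeftCLM ℂ (fun x ↦ ℓ x) u)) x = ℓ m • u x + ℓ x • (∂_{m} u) x := by
  simp only [SchwartzMap.lineDerivOp_apply_eq_fderiv,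
    SchwartzMap.smulLeftCLM_apply ℓ.hasTemperateGrowth]
  rw [fderiv_fun_smul ℓ.differentiableAt u.differentiableAt]
  simp [add_comm]

variable [FiniteDimensional ℝ D] [MeasurableSpace D] [BorelSpace D] {μ : Measure D}
  [μ.IsAddHaarMeasure]

theorem integrable_inner_schwartz (u v : 𝓢(D, ℂ)) : Integrable (fun x ↦ ⟪u x, v x⟫_ℝ) μ :=
  (SchwartzMap.pairing (innerSL ℝ) u v).integrable

theorem integral_inner_lineDerivOp (u v : 𝓢(D, ℂ)) (m : D) :
    ∫ x, ⟪u x, (∂_{m} v) x⟫_ℝ ∂μ = -∫ x, ⟪(∂_{m} u) x, v x⟫_ℝ ∂μ :=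
  SchwartzMap.integral_bilinear_lineDerivOp_right_eq_neg_left u v (innerSL ℝ) m

theorem integrable_norm_sq_schwartz (u : 𝓢(D, ℂ)) : Integrable (fun x ↦ ‖u x‖ ^ 2) μ := by
  simpa only [real_inner_self_eq_norm_sq] using integrable_inner_schwartz (μ := μ) u u

theorem integral_inner_lineDerivOp_lineDerivOp (u : 𝓢(D, ℂ)) (m : D) :
    ∫ x, ⟪u x, (∂_{m} (∂_{m} u)) x⟫_ℝ ∂μ = -∫ x, ‖(∂_{m} u) x‖ ^ 2 ∂μ := by
  simp only [integral_inner_lineDerivOp u, real_inner_self_eq_norm_sq]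

/-- The harmonic oscillator in the direction `m` is bounded below by its ground state energy. -/
theorem mul_integral_norm_sq_le_oscillator (ω : ℝ) (ℓ : D →L[ℝ] ℝ) {m : D} (hm : ℓ m = 1)
    (u : 𝓢(D, ℂ)) :
    ω * ∫ x, ‖u x‖ ^ 2 ∂μ ≤
      ∫ x, ‖(∂_{m} u) x‖ ^ 2 ∂μ + ω ^ 2 * ∫ x, ‖ℓ x • u x‖ ^ 2 ∂μ := by
  set v : 𝓢(D, ℂ) := SchwartzMap.smulLeftCLM ℂ (fun x ↦ ℓ x) u
  have hv (x : D) : v x = ℓ x • u x :=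
    SchwartzMap.smulLeftCLM_apply_apply ℓ.hasTemperateGrowth u x
  have hcross : 2 * ∫ x, ⟪(∂_{m} u) x, v x⟫_ℝ ∂μ = -∫ x, ‖u x‖ ^ 2 ∂μ := by
    have h := integral_inner_lineDerivOp (μ := μ) v u m
    have hpt (x : D) : ⟪(∂_{m} v) x, u x⟫_ℝ = ‖u x‖ ^ 2 + ⟪(∂_{m} u) x, v x⟫_ℝ := by
      rw [lineDerivOp_smulLeftCLM, hm, one_smul, inner_add_left, real_inner_self_eq_norm_sq, hv,
        real_inner_smul_left, real_inner_smul_right]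
    simp only [hpt] at h
    rw [integral_add (integrable_norm_sq_schwartz u) (integrable_inner_schwartz _ _)] at h
    simp only [real_inner_comm (v _)] at h ⊢
    linarith
  have hpos : 0 ≤ ∫ x, ‖(∂_{m} u) x + ω • v x‖ ^ 2 ∂μ := integral_nonneg fun _ ↦ by positivity
  have hexp (x : D) : ‖(∂_{m} u) x + ω • v x‖ ^ 2 =
      ‖(∂_{m} u) x‖ ^ 2 + (2 * ω) * ⟪(∂_{m} u) x, v x⟫_ℝ + ω ^ 2 * ‖v x‖ ^ 2 := by
    rw [norm_add_sq_real, real_inner_smul_right, norm_smul, mul_pow, Real.norm_eq_abs, sq_abs]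
    ring
  simp only [hexp] at hpos
  rw [integral_add, integral_add, integral_const_mul, integral_const_mul] at hpos
  · simp only [hv] at hpos hcross
    linear_combination hpos + ω * hcross
  · exact integrable_norm_sq_schwartz _
  · exact (integrable_inner_schwartz _ _).const_mul _
  · exact (integrable_norm_sq_schwartz _).add ((integrable_inner_schwartz _ _).const_mul _)
  · exact (integrable_norm_sq_schwartz _).const_mul _

/-- The functional `(x₁, z₁, x₂, z₂) ↦ z₂` on ℝ³ × ℝ³. -/
def sndZ : R6 →L[ℝ] ℝ :=
  (ContinuousLinearMap.snd ℝ R2 ℝ).comp (ContinuousLinearMap.snd ℝ R3 R3)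

@[simp]
theorem sndZ_apply (p : R6) : sndZ p = p.2.2 := rfl

theorem re_ip6_S2sq (ω : ℝ) (f : 𝓢(R6, ℂ)) :
    (ip6 f (S2sq ω f)).re = (1 - ω) * (∫ p, ‖f p‖ ^ 2) +
      (∫ p, ‖pd ((0 : R3), ex0) f p‖ ^ 2) + (∫ p, ‖pd ((0 : R3), ex1) f p‖ ^ 2) +
      (∫ p, ‖pd ((0 : R3), ez) f p‖ ^ 2) + ω ^ 2 * ∫ p, ‖sndZ p • f p‖ ^ 2 := by
  set Q : 𝓢(R6, ℂ) →L[ℝ] 𝓢(R6, ℂ) := SchwartzMap.smulLeftCLM ℂ (fun x ↦ sndZ x)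
  have hQ (g : 𝓢(R6, ℂ)) (p : R6) : Q g p = sndZ p • g p :=
    SchwartzMap.smulLeftCLM_apply_apply sndZ.hasTemperateGrowth g p
  set L : R3 → 𝓢(R6, ℂ) := fun v ↦ ∂_{((0 : R3), v)} (∂_{((0 : R3), v)} f)
  set S : 𝓢(R6, ℂ) := (1 - ω) • f - (L ex0 + L ex1 + L ez) + ω ^ 2 • Q (Q f)
  have hSdef (p : R6) :
      S p = (1 - ω) • f p - (L ex0 p + L ex1 p + L ez p) + ω ^ 2 • Q (Q f) p := rfl
  have hS (p : R6) : S2sq ω f p = S p := by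
    rw [hSdef, hQ, hQ, S2sq]
    simp only [lapSnd, pd2, pd_schwartz, L, sndZ_apply, Complex.real_smul]
    push_cast
    ring
  have hint : Integrable (fun p ↦ (starRingEnd ℂ) (f p) * S p) (volume : Measure R6) :=
    (SchwartzMap.pairing ((ContinuousLinearMap.mul ℝ ℂ).comp
      (Complex.conjCLE : ℂ →L[ℝ] ℂ)) f S).integrable
  have hre : (ip6 f (S2sq ω f)).re = ∫ p, ⟪f p, S p⟫_ℝ := by
    simp only [ip6, hS]
    rw [← Complex.reCLM_apply, ← Complex.reCLM.integral_comp_comm hint]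
    refine integral_congr_ae (.of_forall fun p ↦ ?_)
    simp [Complex.inner, mul_comm]
  have hpt (p : R6) : ⟪f p, S p⟫_ℝ = (1 - ω) * ‖f p‖ ^ 2 -
      (⟪f p, L ex0 p⟫_ℝ + ⟪f p, L ex1 p⟫_ℝ + ⟪f p, L ez p⟫_ℝ) +
      ω ^ 2 * ‖sndZ p • f p‖ ^ 2 := by
    rw [hSdef, hQ, hQ, inner_add_right, inner_sub_right, inner_add_right, inner_add_right,
      real_inner_smul_right, real_inner_smul_right, real_inner_self_eq_norm_sq,
      ← real_inner_self_eq_norm_sq (sndZ p • f p), real_inner_smul_left, real_inner_smul_right,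
      real_inner_smul_right]
  have hi (v : R3) : Integrable (fun p ↦ ⟪f p, L v p⟫_ℝ) := integrable_inner_schwartz _ _
  have hf : Integrable (fun p ↦ (1 - ω) * ‖f p‖ ^ 2) :=
    (integrable_norm_sq_schwartz f).const_mul _
  have hz : Integrable (fun p ↦ ω ^ 2 * ‖sndZ p • f p‖ ^ 2) := by
    simpa only [hQ] using (integrable_norm_sq_schwartz (Q f)).const_mul (ω ^ 2)
  have hL (v : R3) : ∫ p, ⟪f p, L v p⟫_ℝ = -∫ p, ‖pd ((0 : R3), v) f p‖ ^ 2 :=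
    integral_inner_lineDerivOp_lineDerivOp f _
  have h01 : Integrable (fun p ↦ ⟪f p, L ex0 p⟫_ℝ + ⟪f p, L ex1 p⟫_ℝ) := (hi ex0).add (hi ex1)
  have h012 : Integrable (fun p ↦ ⟪f p, L ex0 p⟫_ℝ + ⟪f p, L ex1 p⟫_ℝ + ⟪f p, L ez p⟫_ℝ) :=
    h01.add (hi ez)
  have hf012 : Integrable (fun p ↦ (1 - ω) * ‖f p‖ ^ 2 -
      (⟪f p, L ex0 p⟫_ℝ + ⟪f p, L ex1 p⟫_ℝ + ⟪f p, L ez p⟫_ℝ)) := hf.sub h012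
  simp only [hre, hpt]
  rw [integral_add hf012 hz, integral_sub hf h012, integral_add h01 (hi ez),
    integral_add (hi ex0) (hi ex1), hL, hL, hL, integral_const_mul, integral_const_mul]
  ring

end Energy

section Main

open scoped ENNReal NNReal SchwartzMap

/-- The restriction of a Schwartz function on ℝ³ × ℝ³ to the slice `{r₁} × ℝ³`. -/
def slice (f : 𝓢(R6, ℂ)) (r₁ : R3) : 𝓢(R3, ℂ) :=
  SchwartzMap.compCLM ℝ (g := fun r₂ : R3 ↦ (r₁, (0 : R3)) + ContinuousLinearMap.inr ℝ R3 R3 r₂)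
    ((Function.HasTemperateGrowth.const _).add
      (ContinuousLinearMap.inr ℝ R3 R3).hasTemperateGrowth)
    ⟨1, 1, fun r₂ ↦ by
      have : ‖r₂‖ ≤ ‖(r₁, (0 : R3)) + ContinuousLinearMap.inr ℝ R3 R3 r₂‖ := by
        simp [Prod.norm_def]
      linarith⟩ f

@[simp]
theorem slice_apply (f : 𝓢(R6, ℂ)) (r₁ r₂ : R3) : slice f r₁ r₂ = f (r₁, r₂) := by
  simp [slice, SchwartzMap.compCLM_apply]

theorem pd_slice (f : 𝓢(R6, ℂ)) (r₁ r₂ v : R3) :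
    pd v (slice f r₁) r₂ = pd ((0 : R3), v) f (r₁, r₂) := by
  have hs : (slice f r₁ : R3 → ℂ) = fun r ↦ f (r₁, r) := funext (slice_apply f r₁)
  have h : HasFDerivAt (fun r : R3 ↦ f (r₁, r))
      ((fderiv ℝ f (r₁, r₂)).comp (ContinuousLinearMap.inr ℝ R3 R3)) r₂ :=
    (f.hasFDerivAt (r₁, r₂)).comp r₂ (hasFDerivAt_prodMk_right r₁ r₂)
  simp [pd, hs, h.fderiv]

theorem wgradSq_slice (s : ℝ) (f : 𝓢(R6, ℂ)) (p : R6) :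
    wgradSq s (slice f p.1) p.2 = ‖pd ((0 : R3), ex0) f p‖ ^ 2 + ‖pd ((0 : R3), ex1) f p‖ ^ 2 +
      s ^ 2 * ‖pd ((0 : R3), ez) f p‖ ^ 2 := by
  simp only [wgradSq, pd_slice]

theorem integrable_norm_pd_sq (f : 𝓢(R6, ℂ)) (v : R6) : Integrable (fun p ↦ ‖pd v f p‖ ^ 2) := by
  simpa only [pd_schwartz] using integrable_norm_sq_schwartz _

theorem integrable_wgradSq_slice (s : ℝ) (f : 𝓢(R6, ℂ)) :
    Integrable (fun p : R6 ↦ wgradSq s (slice f p.1) p.2) := by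
  simp only [wgradSq_slice]
  exact ((integrable_norm_pd_sq f _).add (integrable_norm_pd_sq f _)).add
    ((integrable_norm_pd_sq f _).const_mul _)

/-- The energy `⟨f, S₂²f⟩` controls the `r₂`-gradient with `z₂`-component weighted by `ω⁻¹`. -/
theorem integral_wgradSq_slice_le {ω s : ℝ} (hω : 1 ≤ ω) (hs : s ^ 2 = ω⁻¹) (f : 𝓢(R6, ℂ)) :
    ∫ p : R6, wgradSq s (slice f p.1) p.2 ≤ (ip6 f (S2sq ω f)).re := by
  have hosc := mul_integral_norm_sq_le_oscillator (μ := volume) ω sndZ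
    (m := ((0 : R3), ez)) (by simp [ez]) f
  simp only [← pd_schwartz] at hosc
  have hsplit : ∫ p : R6, wgradSq s (slice f p.1) p.2 =
      (∫ p, ‖pd ((0 : R3), ex0) f p‖ ^ 2) + (∫ p, ‖pd ((0 : R3), ex1) f p‖ ^ 2) +
        s ^ 2 * ∫ p, ‖pd ((0 : R3), ez) f p‖ ^ 2 := by
    have h01 : Integrable (fun p ↦ ‖pd ((0 : R3), ex0) f p‖ ^ 2 +
        ‖pd ((0 : R3), ex1) f p‖ ^ 2) :=
      (integrable_norm_pd_sq f _).add (integrable_norm_pd_sq f _)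
    simp only [wgradSq_slice]
    rw [integral_add h01 ((integrable_norm_pd_sq f _).const_mul _),
      integral_add (integrable_norm_pd_sq f _) (integrable_norm_pd_sq f _), integral_const_mul]
  have hq : 0 ≤ ∫ p, ‖sndZ p • f p‖ ^ 2 := integral_nonneg fun _ ↦ by positivity
  rw [hsplit, re_ip6_S2sq, hs]
  generalize ∫ p, ‖pd ((0 : R3), ez) f p‖ ^ 2 = z at hosc ⊢
  generalize ∫ p, ‖sndZ p • f p‖ ^ 2 = q at hosc hq ⊢
  generalize ∫ p, ‖f p‖ ^ 2 = m at hosc ⊢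
  have hω0 : 0 < ω := by linarith
  have hz : ω⁻¹ * z ≤ z + ω ^ 2 * q - ω * m + m := by
    have hid : z + ω ^ 2 * q - ω * m + m - ω⁻¹ * z =
        (1 - ω⁻¹) * (z + ω ^ 2 * q - ω * m) + ω⁻¹ * (ω ^ 2 * q) := by
      field_simp
      ring
    have h1 : 0 ≤ (1 - ω⁻¹) * (z + ω ^ 2 * q - ω * m) :=
      mul_nonneg (by linarith [inv_le_one_of_one_le₀ hω]) (by linarith)
    have h2 : 0 ≤ ω⁻¹ * (ω ^ 2 * q) := by positivity
    linarith
  linarith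

/-- The bound by the weighted gradient, obtained slice by slice from Hölder's inequality and the
anisotropic Sobolev inequality. -/
theorem exists_lintegral_potential_le :
    ∃ K : ℝ≥0, ∀ s : ℝ, 0 < s → ∀ W : 𝓢(R3, ℝ), ∀ f : 𝓢(R6, ℂ),
      ∫⁻ p : R6, ‖W (p.1 - p.2)‖ₑ * ‖f p‖ₑ ^ 2 ≤
        eLpNorm W (3 / 2) volume * (K * ENNReal.ofReal (s ^ (-(2 / 3) : ℝ)) *
          ENNReal.ofReal (∫ p : R6, wgradSq s (slice f p.1) p.2)) := by
  obtain ⟨K, hK⟩ := exists_lintegral_pow_three_le_wgradSq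
  refine ⟨K, fun s hs W f ↦ ?_⟩
  set c : ℝ≥0∞ := K * ENNReal.ofReal (s ^ (-(2 / 3) : ℝ))
  have hc : c ≠ ∞ := ENNReal.mul_ne_top ENNReal.coe_ne_top ENNReal.ofReal_ne_top
  have hN : eLpNorm W (3 / 2) volume ≠ ∞ := (W.eLpNorm_lt_top _ _).ne
  have hp : ((3 / 2 : ℝ≥0∞)).toReal = 3 / 2 := by simp
  have hW (r₁ : R3) : (∫⁻ r₂, ‖W (r₁ - r₂)‖ₑ ^ (3 / 2 : ℝ)) ^ (1 / (3 / 2) : ℝ) =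
      eLpNorm W (3 / 2) volume := by
    rw [eLpNorm_eq_lintegral_rpow_enorm_toReal (by simp) (by finiteness), hp,
      lintegral_sub_left_eq_self (fun r ↦ ‖W r‖ₑ ^ (3 / 2 : ℝ)) r₁]
  have hslice (r₁ : R3) : ∫⁻ r₂, ‖W (r₁ - r₂)‖ₑ * ‖f (r₁, r₂)‖ₑ ^ 2 ≤
      eLpNorm W (3 / 2) volume *
        (c * ∫⁻ r₂, ENNReal.ofReal (wgradSq s (slice f r₁) r₂)) := by
    have hWm : Measurable fun r₂ : R3 ↦ ‖W (r₁ - r₂)‖ₑ :=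
      (W.continuous.comp (continuous_const.sub continuous_id)).measurable.enorm
    have hfm : Measurable fun r₂ : R3 ↦ ‖slice f r₁ r₂‖ₑ ^ 2 :=
      (slice f r₁).continuous.measurable.enorm.pow_const 2
    have hol := ENNReal.lintegral_mul_le_Lp_mul_Lq volume
      (Real.holderConjugate_iff.2 ⟨by norm_num, by norm_num⟩ :
        Real.HolderConjugate (3 / 2 : ℝ) 3) hWm.aemeasurable hfm.aemeasurable
    simp only [Pi.mul_apply, hW] at hol
    simp only [slice_apply] at hol
    refine hol.trans ?_
    gcongr
    simpa only [slice_apply] using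
      hK s hs (slice f r₁) ((slice f r₁).smooth 1) ((slice f r₁).memLp 2)
  have hmeas : Measurable fun p : R6 ↦ ‖W (p.1 - p.2)‖ₑ * ‖f p‖ₑ ^ 2 :=
    (W.continuous.comp (continuous_fst.sub continuous_snd)).measurable.enorm.mul
      (f.continuous.measurable.enorm.pow_const 2)
  calc ∫⁻ p : R6, ‖W (p.1 - p.2)‖ₑ * ‖f p‖ₑ ^ 2
      = ∫⁻ r₁, ∫⁻ r₂, ‖W (r₁ - r₂)‖ₑ * ‖f (r₁, r₂)‖ₑ ^ 2 := by
        rw [Measure.volume_eq_prod R3 R3, lintegral_prod _ hmeas.aemeasurable]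
    _ ≤ ∫⁻ r₁, eLpNorm W (3 / 2) volume *
          (c * ∫⁻ r₂, ENNReal.ofReal (wgradSq s (slice f r₁) r₂)) := lintegral_mono hslice
    _ = eLpNorm W (3 / 2) volume *
          (c * ∫⁻ r₁, ∫⁻ r₂, ENNReal.ofReal (wgradSq s (slice f r₁) r₂)) := by
        rw [lintegral_const_mul' _ _ hN, lintegral_const_mul' _ _ hc]
    _ = eLpNorm W (3 / 2) volume *
          (c * ∫⁻ p : R6, ENNReal.ofReal (wgradSq s (slice f p.1) p.2)) := by
        rw [Measure.volume_eq_prod R3 R3,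
          lintegral_prod (fun p : R6 ↦ ENNReal.ofReal (wgradSq s (slice f p.1) p.2))
            (integrable_wgradSq_slice s f).aemeasurable.ennreal_ofReal]
    _ = _ := by
        rw [ofReal_integral_eq_lintegral_ofReal (integrable_wgradSq_slice s f)
          (.of_forall fun p ↦ wgradSq_nonneg _ _ _)]

end Main

/-- `ω |∫∫ W(r₁−r₂)|f|²| ≤ C ω^{4/3} ‖W‖_{L^{3/2}} ⟨f, S₂²f⟩`. -/
theorem omega_potential_estimate :
    ∃ C : ℝ, 0 < C ∧ ∀ ω : ℝ, 1 ≤ ω → ∀ W : SchwartzMap R3 ℝ, ∀ f : SchwartzMap R6 ℂ,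
      ω * |∫ p : R6, W (p.1 - p.2) * ‖f p‖ ^ 2| ≤
        C * ω ^ ((4 : ℝ) / 3) * (eLpNorm (⇑W) (3 / 2) volume).toReal *
          (ip6 (⇑f) (S2sq ω (⇑f))).re := by
  obtain ⟨K, hK⟩ := exists_lintegral_potential_le
  refine ⟨K + 1, by positivity, fun ω hω W f ↦ ?_⟩
  have hω0 : 0 < ω := by linarith
  set s : ℝ := ω ^ (-(1 / 2) : ℝ)
  have hs : 0 < s := Real.rpow_pos_of_pos hω0 _
  have hs2 : s ^ 2 = ω⁻¹ := by
    rw [← Real.rpow_natCast, ← Real.rpow_mul hω0.le, ← Real.rpow_neg_one]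
    norm_num
  have hs3 : s ^ (-(2 / 3) : ℝ) = ω ^ (1 / 3 : ℝ) := by
    rw [← Real.rpow_mul hω0.le]
    norm_num
  have hN : eLpNorm W (3 / 2) volume ≠ ⊤ := (W.eLpNorm_lt_top _ _).ne
  set N : ℝ := (eLpNorm W (3 / 2) volume).toReal
  set I : ℝ := ∫ p : R6, wgradSq s (slice f p.1) p.2
  have hI : 0 ≤ I := integral_nonneg fun p ↦ wgradSq_nonneg _ _ _
  have hIT : I ≤ (ip6 f (S2sq ω f)).re := integral_wgradSq_slice_le hω hs2 f
  have hV : |∫ p : R6, W (p.1 - p.2) * ‖f p‖ ^ 2| ≤ N * (K * ω ^ (1 / 3 : ℝ) * I) := by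
    have h : ‖∫ p : R6, W (p.1 - p.2) * ‖f p‖ ^ 2‖ₑ ≤
        ∫⁻ p : R6, ‖W (p.1 - p.2)‖ₑ * ‖f p‖ₑ ^ 2 := by
      refine (enorm_integral_le_lintegral_enorm _).trans_eq (lintegral_congr fun p ↦ ?_)
      rw [enorm_mul, enorm_pow, enorm_norm]
    have := ENNReal.toReal_mono (by finiteness) (h.trans (hK s hs W f))
    rwa [toReal_enorm, Real.norm_eq_abs, ENNReal.toReal_mul, ENNReal.toReal_mul,
      ENNReal.toReal_mul, ENNReal.toReal_ofReal (by positivity), ENNReal.toReal_ofReal hI,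
      ENNReal.coe_toReal, hs3] at this
  have hω4 : ω * ω ^ (1 / 3 : ℝ) = ω ^ ((4 : ℝ) / 3) := by
    rw [← Real.rpow_one_add' hω0.le (by norm_num)]
    norm_num
  calc ω * |∫ p : R6, W (p.1 - p.2) * ‖f p‖ ^ 2|
      ≤ ω * (N * (K * ω ^ (1 / 3 : ℝ) * I)) := by gcongr
    _ = K * ω ^ ((4 : ℝ) / 3) * N * I := by
        rw [← hω4]
        ring
    _ ≤ (K + 1) * ω ^ ((4 : ℝ) / 3) * N * (ip6 f (S2sq ω f)).re := by
        gcongr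
        linarith
end
end

section
/- There is a constant C > 0 such that for every ω ≥ 1 and every Schwartz function f on ℝ³ = ℝ² × ℝ (variables (x,z)), one has ‖f‖²_{L⁶(ℝ³)} ≤ C ω^{1/3} E_ω(f). -/
open MeasureTheory Complex

noncomputable section

/-- The quadratic form
`E_ω(f) = ‖f‖² + ‖∇ₓf‖² + ‖∂_z f‖² + ω²‖z f‖² − ω‖f‖²` on L²(ℝ³). -/
def Eform (ω : ℝ) (f : R3 → ℂ) : ℝ :=
  (∫ p : R3, ‖f p‖ ^ 2) +
    ((∫ p : R3, ‖pd ex0 f p‖ ^ 2) + (∫ p : R3, ‖pd ex1 f p‖ ^ 2)) +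
    (∫ p : R3, ‖pd ez f p‖ ^ 2) +
    ω ^ 2 * (∫ p : R3, p.2 ^ 2 * ‖f p‖ ^ 2) -
    ω * (∫ p : R3, ‖f p‖ ^ 2)

open Filter Topology NNReal ENNReal LineDeriv

/-- The **Sobolev inequality** for continuously differentiable functions in `Lᵖ`, without any
assumption on the support. -/
theorem eLpNorm_le_eLpNorm_fderiv_of_memLp {E F : Type*} [NormedAddCommGroup E] [NormedSpace ℝ E]
    [FiniteDimensional ℝ E] [MeasurableSpace E] [BorelSpace E] (μ : Measure E)
    [μ.IsAddHaarMeasure] [NormedAddCommGroup F] [NormedSpace ℝ F] [FiniteDimensional ℝ F]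
    {u : E → F} (hu : ContDiff ℝ 1 u) {p p' : ℝ≥0} (hp : 1 ≤ p) (hn : 0 < Module.finrank ℝ E)
    (hp' : (p' : ℝ)⁻¹ = p⁻¹ - (Module.finrank ℝ E : ℝ)⁻¹) (hup : MemLp u p μ) :
    eLpNorm u p' μ ≤ SNormLESNormFDerivOfEqConst F μ p * eLpNorm (fderiv ℝ u) p μ := by
  let φ : ContDiffBump (0 : E) := ⟨1, 2, one_pos, one_lt_two⟩
  obtain ⟨K, hK⟩ := (φ.contDiff (n := 1)).continuous_fderiv one_ne_zero
    |>.bounded_above_of_compact_support (φ.hasCompactSupport.fderiv ℝ)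
  have hK0 : 0 ≤ K := (norm_nonneg _).trans (hK 0)
  let c : ℕ → ℝ := fun n ↦ ((n : ℝ) + 1)⁻¹
  have hc (n : ℕ) : 0 < c n := by positivity
  have hc0 : Tendsto c atTop (𝓝 0) := by
    simpa [c] using tendsto_one_div_add_atTop_nhds_zero_nat (𝕜 := ℝ)
  let v : ℕ → E → F := fun n x ↦ φ (c n • x) • u x
  have hφ (n : ℕ) : ContDiff ℝ 1 (fun x ↦ φ (c n • x)) :=
    φ.contDiff.comp (contDiff_const_smul _)
  have hv (n : ℕ) : ContDiff ℝ 1 (v n) := (hφ n).smul hu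
  have hvc (n : ℕ) : HasCompactSupport (v n) :=
    (φ.hasCompactSupport.comp_smul (hc n).ne').smul_right
  have hdφ (n : ℕ) (x : E) : ‖fderiv ℝ (fun x ↦ φ (c n • x)) x‖ ≤ c n * K := by
    rw [fderiv_comp_smul, norm_smul, Real.norm_of_nonneg (hc n).le]
    exact mul_le_mul_of_nonneg_left (hK _) (hc n).le
  have hdv (n : ℕ) (x : E) : ‖fderiv ℝ (v n) x‖ ≤ ‖fderiv ℝ u x‖ + c n * K * ‖u x‖ := by
    have h := fderiv_fun_smul ((hφ n).differentiable one_ne_zero x)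
      (hu.differentiable one_ne_zero x)
    rw [show v n = fun x ↦ φ (c n • x) • u x from rfl, h]
    refine (norm_add_le _ _).trans (add_le_add ?_ ?_)
    · rw [norm_smul, Real.norm_of_nonneg φ.nonneg]
      exact mul_le_of_le_one_left (norm_nonneg _) φ.le_one
    · rw [ContinuousLinearMap.norm_smulRight_apply]
      exact mul_le_mul_of_nonneg_right (hdφ n x) (norm_nonneg _)
  have hmeas : AEStronglyMeasurable (fderiv ℝ u) μ :=
    (hu.continuous_fderiv one_ne_zero).aestronglyMeasurable
  have hle (n : ℕ) : eLpNorm (v n) p' μ ≤ SNormLESNormFDerivOfEqConst F μ p *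
      (eLpNorm (fderiv ℝ u) p μ + ENNReal.ofReal (c n * K) * eLpNorm u p μ) := by
    refine (eLpNorm_le_eLpNorm_fderiv_of_eq μ (hv n) (hvc n) hp hn hp').trans ?_
    gcongr
    have h1 : eLpNorm (fderiv ℝ (v n)) p μ ≤
        eLpNorm ((fun x ↦ ‖fderiv ℝ u x‖) + fun x ↦ c n * K * ‖u x‖) p μ :=
      eLpNorm_mono_real (hdv n)
    refine h1.trans ((eLpNorm_add_le hmeas.norm (hup.1.norm.const_mul _)
      (by exact_mod_cast hp)).trans ?_)
    rw [eLpNorm_norm]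
    gcongr
    refine (eLpNorm_const_smul_le (c := c n * K) (f := fun x ↦ ‖u x‖)).trans ?_
    rw [eLpNorm_norm, Real.enorm_of_nonneg (mul_nonneg (hc n).le hK0)]
  have hlim : Tendsto (fun n ↦ (SNormLESNormFDerivOfEqConst F μ p : ℝ≥0∞) *
      (eLpNorm (fderiv ℝ u) p μ + ENNReal.ofReal (c n * K) * eLpNorm u p μ)) atTop
      (𝓝 (SNormLESNormFDerivOfEqConst F μ p * eLpNorm (fderiv ℝ u) p μ)) := by
    have h0 : Tendsto (fun n ↦ ENNReal.ofReal (c n * K)) atTop (𝓝 0) := by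
      simpa using ENNReal.tendsto_ofReal (hc0.mul_const K)
    have h1 := ENNReal.Tendsto.mul_const h0 (Or.inr hup.2.ne)
    have h2 := (tendsto_const_nhds (x := eLpNorm (fderiv ℝ u) p μ)).add h1
    simpa using ENNReal.Tendsto.const_mul h2 (Or.inr ENNReal.coe_ne_top)
  have hpt : ∀ᵐ x ∂μ, Tendsto (fun n ↦ v n x) atTop (𝓝 (u x)) := by
    refine Eventually.of_forall fun x ↦ ?_
    have h1 : Tendsto (fun n ↦ φ (c n • x)) atTop (𝓝 1) := by
      have h := (φ.continuous.tendsto 0).comp (by simpa using hc0.smul_const x)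
      rwa [φ.one_of_mem_closedBall (Metric.mem_closedBall_self φ.rIn_pos.le)] at h
    simpa using h1.smul_const (u x)
  calc eLpNorm u p' μ ≤ liminf (fun n ↦ eLpNorm (v n) p' μ) atTop :=
        Lp.eLpNorm_lim_le_liminf_eLpNorm (fun n ↦ (hv n).continuous.aestronglyMeasurable) u hpt
    _ ≤ _ := (liminf_le_liminf (Eventually.of_forall hle)).trans_eq hlim.liminf_eq

instance inst_s5 : (volume : Measure R3).IsAddHaarMeasure :=
  inferInstanceAs ((volume : Measure R2).prod (volume : Measure ℝ)).IsAddHaarMeasure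

/-- Behaviour of `Lᵖ` norms under dilation of the last variable. -/
theorem eLpNorm_comp_dilate_snd {G : Type*} [NormedAddCommGroup G] {h : R3 → G}
    (hh : Continuous h) {a : ℝ} (ha : 0 < a) {p : ℝ≥0∞} (hp : p ≠ ⊤) :
    eLpNorm (fun q : R3 ↦ h (q.1, a * q.2)) p volume =
      ENNReal.ofReal a⁻¹ ^ (1 / p).toReal * eLpNorm h p volume := by
  have hmap : Measure.map (Prod.map id (a * ·)) (volume : Measure R3) =
      ENNReal.ofReal a⁻¹ • (volume : Measure R3) := by
    rw [Measure.volume_eq_prod, ← Measure.map_prod_map _ _ measurable_id (by fun_prop),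
      Real.map_volume_mul_left ha.ne', Measure.map_id, Measure.prod_smul_right,
      abs_of_pos (inv_pos.2 ha)]
  have h1 := eLpNorm_map_measure (p := p) (f := Prod.map id (a * ·)) (μ := (volume : Measure R3))
    (g := h) hh.aestronglyMeasurable (by fun_prop)
  rw [hmap, eLpNorm_smul_measure_of_ne_top hp] at h1
  exact h1.symm

/-- The operator norm of a linear map on `ℝ² × ℝ` is controlled by its values on the axes. -/
theorem opNorm_le_sum_axes (L : R3 →L[ℝ] ℂ) : ‖L‖ ≤ ‖L ex0‖ + ‖L ex1‖ + ‖L ez‖ := by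
  refine L.opNorm_le_bound (by positivity) fun v ↦ ?_
  have hv : v = v.1 0 • ex0 + v.1 1 • ex1 + v.2 • ez := by
    refine Prod.ext ?_ (by simp [ex0, ex1, ez])
    ext i
    fin_cases i <;> simp [ex0, ex1, ez]
  have h0 : ‖v.1 0‖ ≤ ‖v‖ := (PiLp.norm_apply_le v.1 0).trans (norm_fst_le v)
  have h1 : ‖v.1 1‖ ≤ ‖v‖ := (PiLp.norm_apply_le v.1 1).trans (norm_fst_le v)
  have h2 : ‖v.2‖ ≤ ‖v‖ := norm_snd_le v
  calc ‖L v‖ = ‖v.1 0 • L ex0 + v.1 1 • L ex1 + v.2 • L ez‖ := by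
        conv_lhs => rw [hv]
        simp only [map_add, map_smul]
    _ ≤ ‖v.1 0‖ * ‖L ex0‖ + ‖v.1 1‖ * ‖L ex1‖ + ‖v.2‖ * ‖L ez‖ := by
        simpa only [norm_smul] using norm_add₃_le (a := v.1 0 • L ex0) (b := v.1 1 • L ex1)
          (c := v.2 • L ez)
    _ ≤ ‖v‖ * ‖L ex0‖ + ‖v‖ * ‖L ex1‖ + ‖v‖ * ‖L ez‖ := by gcongr
    _ = (‖L ex0‖ + ‖L ex1‖ + ‖L ez‖) * ‖v‖ := by ring

/-- A directional derivative of a Schwartz function, as a Schwartz function. -/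
theorem pd_eq_lineDeriv (f : SchwartzMap R3 ℂ) (v : R3) :
    pd v f = ⇑(∂_{v} f : SchwartzMap R3 ℂ) := by
  ext x
  rw [SchwartzMap.lineDerivOp_apply_eq_fderiv, pd]

theorem continuous_pd_s5 (f : SchwartzMap R3 ℂ) (v : R3) : Continuous (pd v f) := by
  rw [pd_eq_lineDeriv]
  exact SchwartzMap.continuous _

theorem memLp_pd (f : SchwartzMap R3 ℂ) (v : R3) : MemLp (pd v f) 2 volume := by
  rw [pd_eq_lineDeriv]
  exact SchwartzMap.memLp _ 2 volume

/-- The Sobolev inequality applied to the dilates `f(x, a z)`. -/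
theorem exists_dilated_sobolev : ∃ C : ℝ≥0, ∀ (f : SchwartzMap R3 ℂ) (a : ℝ), 0 < a →
    ENNReal.ofReal a⁻¹ ^ ((1 : ℝ) / 6) * eLpNorm f 6 volume ≤
      C * (ENNReal.ofReal a⁻¹ ^ ((1 : ℝ) / 2) * (eLpNorm (pd ex0 f) 2 volume +
        eLpNorm (pd ex1 f) 2 volume + ENNReal.ofReal a * eLpNorm (pd ez f) 2 volume)) := by
  refine ⟨SNormLESNormFDerivOfEqConst ℂ (volume : Measure R3) 2, fun f a ha ↦ ?_⟩
  let A : R3 →L[ℝ] R3 := (ContinuousLinearMap.fst ℝ R2 ℝ).prod (a • ContinuousLinearMap.snd ℝ R2 ℝ)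
  have hA (q : R3) : A q = (q.1, a * q.2) := rfl
  let g : R3 → ℂ := fun q ↦ f (q.1, a * q.2)
  have hgd (q : R3) : fderiv ℝ g q = (fderiv ℝ f (q.1, a * q.2)).comp A :=
    ((f.differentiableAt (x := A q)).hasFDerivAt.comp q A.hasFDerivAt).fderiv
  have hgs : ContDiff ℝ 1 g := (f.smooth 1).comp A.contDiff
  have hfin : Module.finrank ℝ R3 = 3 := by simp
  have hscale2 {G : Type} [NormedAddCommGroup G] {h : R3 → G} (hh : Continuous h) :
      eLpNorm (fun q : R3 ↦ h (q.1, a * q.2)) 2 volume =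
        ENNReal.ofReal a⁻¹ ^ ((1 : ℝ) / 2) * eLpNorm h 2 volume := by
    simpa using eLpNorm_comp_dilate_snd hh ha (p := 2) (by simp)
  have hg2 : MemLp g 2 volume := by
    refine ⟨hgs.continuous.aestronglyMeasurable, ?_⟩
    rw [hscale2 f.continuous]
    exact ENNReal.mul_lt_top (ENNReal.rpow_lt_top_of_nonneg (by norm_num) (by simp))
      (f.memLp 2 volume).2
  have hsob := eLpNorm_le_eLpNorm_fderiv_of_memLp (volume : Measure R3) hgs (p := 2) (p' := 6)
    (by norm_num) (by rw [hfin]; norm_num) (by rw [hfin]; norm_num) (by simpa using hg2)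
  have h6 : eLpNorm g 6 volume = ENNReal.ofReal a⁻¹ ^ ((1 : ℝ) / 6) * eLpNorm f 6 volume := by
    simpa using eLpNorm_comp_dilate_snd f.continuous ha (p := 6) (by simp)
  rw [← h6]
  refine le_trans (by simpa using hsob) ?_
  gcongr
  have hA0 : A ex0 = ex0 := by simp [hA, ex0]
  have hA1 : A ex1 = ex1 := by simp [hA, ex1]
  have hAz : A ez = a • ez := by simp [hA, ez]
  have hc (v : R3) : Continuous (fun q : R3 ↦ pd v f (q.1, a * q.2)) :=
    (continuous_pd_s5 f v).comp A.continuous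
  have hpt (q : R3) : ‖fderiv ℝ g q‖ ≤ ‖pd ex0 f (q.1, a * q.2)‖ +
      ‖pd ex1 f (q.1, a * q.2)‖ + a * ‖pd ez f (q.1, a * q.2)‖ := by
    refine (opNorm_le_sum_axes _).trans_eq ?_
    simp only [hgd, ContinuousLinearMap.comp_apply, hA0, hA1, hAz, map_smul, norm_smul,
      Real.norm_of_nonneg ha.le, pd]
  have hn0 := (hc ex0).norm.aestronglyMeasurable (μ := (volume : Measure R3))
  have hn1 := (hc ex1).norm.aestronglyMeasurable (μ := (volume : Measure R3))
  have hnz := (hc ez).norm.aestronglyMeasurable (μ := (volume : Measure R3))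
  calc eLpNorm (fderiv ℝ g) 2 volume
      ≤ eLpNorm (((fun q : R3 ↦ ‖pd ex0 f (q.1, a * q.2)‖) +
          fun q : R3 ↦ ‖pd ex1 f (q.1, a * q.2)‖) +
          a • fun q : R3 ↦ ‖pd ez f (q.1, a * q.2)‖) 2 volume := eLpNorm_mono_real hpt
    _ ≤ eLpNorm (fun q : R3 ↦ ‖pd ex0 f (q.1, a * q.2)‖) 2 volume +
          eLpNorm (fun q : R3 ↦ ‖pd ex1 f (q.1, a * q.2)‖) 2 volume +
          ENNReal.ofReal a * eLpNorm (fun q : R3 ↦ ‖pd ez f (q.1, a * q.2)‖) 2 volume := by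
        refine (eLpNorm_add_le (hn0.add hn1) (hnz.const_smul a) (by norm_num)).trans ?_
        gcongr
        · exact eLpNorm_add_le hn0 hn1 (by norm_num)
        · rw [eLpNorm_const_smul, Real.enorm_of_nonneg ha.le]
    _ = ENNReal.ofReal a⁻¹ ^ ((1 : ℝ) / 2) * (eLpNorm (pd ex0 f) 2 volume +
          eLpNorm (pd ex1 f) 2 volume + ENNReal.ofReal a * eLpNorm (pd ez f) 2 volume) := by
        simp only [eLpNorm_norm, hscale2 (continuous_pd_s5 f _)]
        ring

theorem toReal_eLpNorm_two_sq {X G : Type*} [MeasurableSpace X] {μ : Measure X}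
    [NormedAddCommGroup G] {g : X → G} (hg : MemLp g 2 μ) :
    (eLpNorm g 2 μ).toReal ^ 2 = ∫ x, ‖g x‖ ^ 2 ∂μ := by
  have h0 : 0 ≤ ∫ x, ‖g x‖ ^ 2 ∂μ := integral_nonneg fun x ↦ by positivity
  rw [hg.eLpNorm_eq_integral_rpow_norm (by norm_num) (by norm_num)]
  simp only [ENNReal.toReal_ofNat, Real.rpow_ofNat]
  rw [ENNReal.toReal_ofReal (by positivity), ← Real.rpow_natCast, ← Real.rpow_mul h0]
  norm_num

theorem integrable_inner_of_memLp_two {X : Type*} [MeasurableSpace X] {μ : Measure X}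
    {G : Type*} [NormedAddCommGroup G] [InnerProductSpace ℝ G] {g h : X → G}
    (hg : MemLp g 2 μ) (hh : MemLp h 2 μ) : Integrable (fun x ↦ inner ℝ (g x) (h x)) μ := by
  refine (hg.norm.integrable_mul hh.norm).mono (hg.1.inner hh.1) (Eventually.of_forall fun x ↦ ?_)
  simpa using norm_inner_le_norm (𝕜 := ℝ) (g x) (h x)

/-- The ground state energy of the harmonic oscillator `-∂_z² + ω² z²` is at least `ω`. -/
theorem harmonic_oscillator_lower_bound (ω : ℝ) (f : SchwartzMap R3 ℂ) :
    ω * (∫ p : R3, ‖f p‖ ^ 2) ≤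
      (∫ p : R3, ‖pd ez f p‖ ^ 2) + ω ^ 2 * (∫ p : R3, p.2 ^ 2 * ‖f p‖ ^ 2) := by
  have hz : (fun p : R3 ↦ p.2).HasTemperateGrowth :=
    (ContinuousLinearMap.snd ℝ R2 ℝ).hasTemperateGrowth
  let g : SchwartzMap R3 ℂ := SchwartzMap.smulLeftCLM ℂ (fun p : R3 ↦ p.2) f
  have hg (p : R3) : g p = p.2 • f p := SchwartzMap.smulLeftCLM_apply_apply hz f p
  have hfz : MemLp (pd ez f) 2 volume := memLp_pd f ez
  have hf2 : MemLp f 2 volume := f.memLp 2 volume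
  have hg2 : MemLp g 2 volume := g.memLp 2 volume
  have hgd (p : R3) : fderiv ℝ g p ez = f p + p.2 • pd ez f p := by
    have h1 := ((ContinuousLinearMap.snd ℝ R2 ℝ).hasFDerivAt (x := p)).smul
      (f.differentiableAt (x := p)).hasFDerivAt
    rw [show (g : R3 → ℂ) = (ContinuousLinearMap.snd ℝ R2 ℝ : R3 → ℝ) • (f : R3 → ℂ) from funext hg]
    rw [h1.fderiv]
    simp [ez, pd, add_comm]
  have hI1 : Integrable (fun p : R3 ↦ inner ℝ (g p) (pd ez f p)) :=
    integrable_inner_of_memLp_two hg2 hfz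
  have hI0 : Integrable (fun p : R3 ↦ ‖f p‖ ^ 2) := hf2.integrable_norm_pow two_ne_zero
  have hIz : Integrable (fun p : R3 ↦ ‖pd ez f p‖ ^ 2) := hfz.integrable_norm_pow two_ne_zero
  have hIg : Integrable (fun p : R3 ↦ ‖g p‖ ^ 2) := hg2.integrable_norm_pow two_ne_zero
  have hsplit (p : R3) : inner ℝ (fderiv ℝ g p ez) (f p) =
      ‖f p‖ ^ 2 + inner ℝ (g p) (pd ez f p) := by
    rw [hgd, hg, inner_add_left, real_inner_self_eq_norm_sq, real_inner_smul_left,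
      real_inner_smul_left, real_inner_comm]
  have hparts : ∫ p : R3, inner ℝ (g p) (pd ez f p) =
      - ∫ p : R3, (‖f p‖ ^ 2 + inner ℝ (g p) (pd ez f p)) := by
    have hI2 : Integrable (fun p : R3 ↦ inner ℝ (fderiv ℝ g p ez) (f p)) := by
      simp only [hsplit]
      exact hI0.add hI1
    have h : ∫ p : R3, inner ℝ (g p) (pd ez f p) = - ∫ p : R3, inner ℝ (fderiv ℝ g p ez) (f p) :=
      integral_bilinear_fderiv_right_eq_neg_left_of_integrable
        (μ := (volume : Measure R3)) (f := g) (g := f) (v := ez) (B := innerSL ℝ)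
        hI2 hI1 (integrable_inner_of_memLp_two hg2 hf2)
        (fun p _ ↦ g.differentiableAt) (fun p _ ↦ f.differentiableAt)
    simpa only [hsplit] using h
  rw [integral_add hI0 hI1] at hparts
  have hsq : 0 ≤ ∫ p : R3, ‖pd ez f p + ω • g p‖ ^ 2 := integral_nonneg fun p ↦ by positivity
  have hexp (p : R3) : ‖pd ez f p + ω • g p‖ ^ 2 =
      ‖pd ez f p‖ ^ 2 + 2 * ω * inner ℝ (g p) (pd ez f p) + ω ^ 2 * ‖g p‖ ^ 2 := by
    rw [norm_add_sq_real, real_inner_smul_right, norm_smul, mul_pow, Real.norm_eq_abs, sq_abs,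
      real_inner_comm]
    ring
  simp only [hexp] at hsq
  rw [integral_add (f := fun p : R3 ↦ _ + _) (hIz.add (hI1.const_mul _)) (hIg.const_mul _),
    integral_add hIz (hI1.const_mul _), integral_const_mul, integral_const_mul] at hsq
  have hgn (p : R3) : ‖g p‖ ^ 2 = p.2 ^ 2 * ‖f p‖ ^ 2 := by
    rw [hg, norm_smul, mul_pow, Real.norm_eq_abs, sq_abs]
  simp only [hgn] at hsq
  linear_combination hsq + ω * hparts

/-- there is `C > 0` such that for every `ω ≥ 1` and every Schwartz
function `f` on ℝ³, `‖f‖²_{L⁶} ≤ C ω^{1/3} E_ω(f)`. -/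
theorem L6_bound_by_energy_form :
    ∃ C : ℝ, 0 < C ∧ ∀ ω : ℝ, 1 ≤ ω → ∀ f : SchwartzMap R3 ℂ,
      (eLpNorm (⇑f) 6 volume).toReal ^ 2 ≤ C * ω ^ ((1 : ℝ) / 3) * Eform ω (⇑f) := by
  obtain ⟨C, hC⟩ := exists_dilated_sobolev
  refine ⟨16 * (C : ℝ) ^ 2 + 1, by positivity, fun ω hω f ↦ ?_⟩
  have hω0 : 0 < ω := by linarith
  set m : ℝ := ω ^ ((1 : ℝ) / 12) with hm
  have hm0 : 0 < m := by positivity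
  have hm12 : m ^ 12 = ω := by
    rw [hm, ← Real.rpow_natCast, ← Real.rpow_mul hω0.le]
    norm_num
  have hm4 : ω ^ ((1 : ℝ) / 3) = m ^ 4 := by
    rw [hm, ← Real.rpow_natCast, ← Real.rpow_mul hω0.le]
    norm_num
  have hroot (k n : ℕ) (r : ℝ) (hr : (k : ℝ) * r = n) :
      ENNReal.ofReal (m ^ k) ^ r = ENNReal.ofReal (m ^ n) := by
    rw [ENNReal.ofReal_rpow_of_pos (by positivity), ← Real.rpow_natCast, ← Real.rpow_mul hm0.le, hr,
      Real.rpow_natCast]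
  have hsob := hC f (m ^ 6)⁻¹ (by positivity)
  rw [inv_inv, hroot 6 1 _ (by norm_num), hroot 6 3 _ (by norm_num)] at hsob
  have h0 := memLp_pd f ex0
  have h1 := memLp_pd f ex1
  have hz := memLp_pd f ez
  have hsobR := ENNReal.toReal_mono (by finiteness [h0.2.ne, h1.2.ne, hz.2.ne]) hsob
  rw [ENNReal.toReal_mul, ENNReal.toReal_mul, ENNReal.toReal_mul,
    ENNReal.toReal_add (by finiteness [h0.2.ne, h1.2.ne]) (by finiteness [hz.2.ne]),
    ENNReal.toReal_add h0.2.ne h1.2.ne, ENNReal.toReal_mul, ENNReal.toReal_ofReal (by positivity),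
    ENNReal.toReal_ofReal (by positivity), ENNReal.toReal_ofReal (by positivity),
    ENNReal.coe_toReal] at hsobR
  have hosc := harmonic_oscillator_lower_bound ω f
  have e0 := toReal_eLpNorm_two_sq h0
  have e1 := toReal_eLpNorm_two_sq h1
  have ez' := toReal_eLpNorm_two_sq hz
  have hM : 0 ≤ ∫ p : R3, ‖f p‖ ^ 2 := integral_nonneg fun p ↦ by positivity
  have hE : Eform ω f = Eform ω f := rfl
  conv_rhs at hE => rw [Eform, ← e0, ← e1, ← ez']
  rw [← ez'] at hosc
  set N := (eLpNorm f 6 volume).toReal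
  set X := (eLpNorm (pd ex0 f) 2 volume).toReal
  set Y := (eLpNorm (pd ex1 f) 2 volume).toReal
  set Z := (eLpNorm (pd ez f) 2 volume).toReal
  set M := ∫ p : R3, ‖f p‖ ^ 2
  set W := ∫ p : R3, p.2 ^ 2 * ‖f p‖ ^ 2
  set e := Eform ω f
  have hN : 0 ≤ N := ENNReal.toReal_nonneg
  have hX2 : X ^ 2 ≤ e := by nlinarith [sq_nonneg Y]
  have hY2 : Y ^ 2 ≤ e := by nlinarith [sq_nonneg X]
  have hMe : M ≤ e := by nlinarith [sq_nonneg X, sq_nonneg Y]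
  have he : 0 ≤ e := hM.trans hMe
  have hZ2 : Z ^ 2 ≤ 4 * (ω * e) := by
    have hW : 0 ≤ ω ^ 2 * W := mul_nonneg (sq_nonneg _) (integral_nonneg fun p ↦ by positivity)
    nlinarith [sq_nonneg X, sq_nonneg Y, mul_le_mul_of_nonneg_left hMe hω0.le,
      mul_le_mul_of_nonneg_right hω he]
  have hs := Real.sq_sqrt he
  have hs0 := Real.sqrt_nonneg e
  have hX : X ≤ √e := Real.le_sqrt_of_sq_le hX2
  have hY : Y ≤ √e := Real.le_sqrt_of_sq_le hY2
  have hZ : Z ≤ 2 * m ^ 6 * √e := by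
    refine abs_le_of_sq_le_sq' ?_ (by positivity) |>.2
    rw [mul_pow, hs]
    refine hZ2.trans_eq ?_
    rw [← hm12]
    ring
  have hbound : m * N ≤ m * (4 * C * m ^ 2 * √e) := by
    have hZ' : (m ^ 6)⁻¹ * Z ≤ 2 * √e := by
      rw [inv_mul_le_iff₀ (by positivity)]
      linarith
    calc m * N = m ^ 1 * N := by rw [pow_one]
      _ ≤ C * (m ^ 3 * (X + Y + (m ^ 6)⁻¹ * Z)) := hsobR
      _ ≤ C * (m ^ 3 * (√e + √e + 2 * √e)) := by gcongr
      _ = m * (4 * C * m ^ 2 * √e) := by ring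
  have hNle : N ≤ 4 * C * m ^ 2 * √e := le_of_mul_le_mul_left hbound hm0
  calc N ^ 2 ≤ (4 * C * m ^ 2 * √e) ^ 2 := by gcongr
    _ = 16 * C ^ 2 * m ^ 4 * e := by rw [mul_pow, hs]; ring
    _ ≤ (16 * C ^ 2 + 1) * ω ^ ((1 : ℝ) / 3) * e := by
      rw [hm4]
      gcongr
      linarith
end
end
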